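/- arXiv:1901.11109 — 4 statements merged into one kernel-verified Lean document; each statement's English description precedes it below -/
import Mathlib

section
/- Let K be a commutative ring, n a nonnegative integer, and k in {0,1,...,n}. Let A = (a_{i,j}) and B = (b_{i,j}) be (n+1)×(n+1) matrices over K with b_{n+1,n+1} = 0. Let W be the matrix indexed by k-element subsets of {1,...,n}, whose (I,J)-entry is det(sub_{I+}^{J+} A) · det(sub_{I+}^{J+} B), where I+ = I ∪ {n+1} and sub_U^V M denotes the submatrix of M with rows U and columns V. Then det A divides det W in K. -/
open Matrix Finset

/-- For `I ⊆ {0,...,n-1}` (as a finset of `Fin n`), the subset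
`I+ = I ∪ {n}` of `Fin (n+1)`. -/
def Finset.plus {n : ℕ} (I : Finset (Fin n)) : Finset (Fin (n + 1)) :=
  I.image Fin.castSucc ∪ {Fin.last n}

theorem Finset.plus_card {n k : ℕ} {I : Finset (Fin n)} (h : I.card = k) :
    I.plus.card = k + 1 := by
  unfold Finset.plus
  rw [Finset.card_union_of_disjoint, Finset.card_image_of_injective _ (Fin.castSucc_injective n),
    h, Finset.card_singleton]
  simp only [Finset.disjoint_singleton_right, Finset.mem_image, not_exists]
  rintro x ⟨hx, hxx⟩
  exact (Fin.castSucc_lt_last x).ne hxx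

/-- The minor of the `(n+1) × (n+1)` matrix `A` with rows indexed by `I+` and
columns indexed by `J+`, where `I, J` are `k`-element subsets of `{0,...,n-1}`. -/
noncomputable def minorPlus {K : Type*} [CommRing K] {n k : ℕ}
    (A : Matrix (Fin (n + 1)) (Fin (n + 1)) K)
    (I J : {s : Finset (Fin n) // s.card = k}) : K :=
  Matrix.det (Matrix.of fun a b : Fin (k + 1) =>
    A ((I.1.plus.orderIsoOfFin (Finset.plus_card I.2)) a)
      ((J.1.plus.orderIsoOfFin (Finset.plus_card J.2)) b))

theorem aux_det_vars {N σ S : Type*} [Fintype N] [DecidableEq N] [CommRing S] (s : Set σ)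
    (M : Matrix N N (MvPolynomial σ S)) (h : ∀ i j, M i j ∈ MvPolynomial.supported S s) :
    M.det ∈ MvPolynomial.supported S s := by
  rw [det_apply']
  refine Subalgebra.sum_mem _ fun τ _ => Subalgebra.mul_mem _ ?_ (Subalgebra.prod_mem _ fun i _ => h _ _)
  exact intCast_mem _ _

theorem aux_notMem {σ S : Type*} [CommRing S] (v : σ) (p : MvPolynomial σ S)
    (h : p ∈ MvPolynomial.supported S ({v}ᶜ : Set σ)) : v ∉ p.vars := by
  rw [MvPolynomial.mem_supported] at h
  intro hv
  exact h hv rfl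

theorem aux_X_supp {σ S : Type*} [CommRing S] (v w : σ) (h : w ≠ v) :
    (MvPolynomial.X w : MvPolynomial σ S) ∈ MvPolynomial.supported S ({v}ᶜ : Set σ) := by
  classical
  rw [MvPolynomial.mem_supported]
  intro x hx
  by_cases hS : Nontrivial S
  · simp [MvPolynomial.vars_X] at hx
    simpa [hx] using h
  · have := not_nontrivial_iff_subsingleton.1 hS
    have h0 : (MvPolynomial.X w : MvPolynomial σ S) = 0 := Subsingleton.elim _ _
    simp [h0] at hx

theorem aux_notMem_dvd {σ S : Type*} [CommRing S] [IsDomain S] (v : σ) (p q : MvPolynomial σ S)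
    (hq : q ≠ 0) (h : p ∣ q) (hv : v ∉ q.vars) : v ∉ p.vars := by
  obtain ⟨r, rfl⟩ := h
  rw [MvPolynomial.mem_vars_iff_degreeOf_ne_zero] at hv ⊢
  rw [MvPolynomial.degreeOf_mul_eq (left_ne_zero_of_mul hq) (right_ne_zero_of_mul hq)] at hv
  omega

theorem aux_adj_eval {N S : Type*} [Fintype N] [DecidableEq N] [CommRing S]
    (a i : N) :
    ((Equiv.swap a i).permMatrix S).updateRow i (Pi.single a 1) = (Equiv.swap a i).permMatrix S := by
  ext x y
  by_cases h : x = i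
  · subst h
    simp [Equiv.Perm.permMatrix, PEquiv.toMatrix_apply, Pi.single_apply, eq_comm]
  · simp [h]

theorem aux_adj_ne {N S : Type*} [Fintype N] [DecidableEq N] [CommRing S] [IsDomain S]
    (a i : N) : ¬ (mvPolynomialX N N S).det ∣ (mvPolynomialX N N S).adjugate a i := by
  intro h
  let P : Matrix N N S := ((Equiv.swap a i).permMatrix S).updateRow i 0
  have h2 := map_dvd (MvPolynomial.eval fun p : N × N => P p.1 p.2) h
  rw [RingHom.map_det, mvPolynomialX_mapMatrix_eval] at h2
  have h3 : (MvPolynomial.eval fun p : N × N => P p.1 p.2) ((mvPolynomialX N N S).adjugate a i)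
      = P.adjugate a i := by
    conv_rhs => rw [← mvPolynomialX_mapMatrix_eval P]
    rw [← RingHom.map_adjugate]; rfl
  rw [h3, adjugate_apply, det_eq_zero_of_row_eq_zero (A := P) i (by simp [P])] at h2
  simp only [P, updateRow_idem, aux_adj_eval, det_permutation, zero_dvd_iff] at h2
  rcases Int.units_eq_one_or (Equiv.Perm.sign (Equiv.swap a i)) with h | h <;> simp [h] at h2

theorem aux_irred {N S : Type*} [Fintype N] [DecidableEq N] [CommRing S] [IsDomain S] (o : N) :
    Irreducible (mvPolynomialX N N S).det := by
  set Z := mvPolynomialX N N S with hZ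
  have hne : ∀ i, Z.adjugate o i ≠ 0 := fun i h => aux_adj_ne (S := S) o i (by rw [← hZ, h]; exact dvd_zero _)
  have hone : ∀ v i j, (Pi.single (M := fun _ : N => MvPolynomial (N × N) S) i 1 j) ∈
      MvPolynomial.supported S ({v}ᶜ : Set (N × N)) := by
    intro v i j
    rw [Pi.single_apply]; split_ifs
    · exact one_mem _
    · exact zero_mem _
  have hrow : ∀ i l, (i, l) ∉ (Z.adjugate o i).vars := by
    intro i l
    apply aux_notMem
    rw [adjugate_apply]
    apply aux_det_vars
    intro a b
    by_cases h : a = i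
    · subst h; simpa using hone _ _ _
    · rw [updateRow_ne h]
      exact aux_X_supp _ _ (by simp [h])
  have hcolE : ∀ i, Z.adjugate o i = (Z.updateCol o (Pi.single i 1)).det := by
    intro i
    have := congrFun (congrFun (adjugate_transpose Z) i) o
    rw [transpose_apply] at this
    rw [this, adjugate_apply, updateRow_transpose, det_transpose]
  have hcol : ∀ i k, (k, o) ∉ (Z.adjugate o i).vars := by
    intro i k
    apply aux_notMem
    rw [hcolE]
    apply aux_det_vars
    intro a b
    by_cases h : b = o
    · subst h; simpa using hone _ _ _
    · rw [updateCol_ne h]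
      exact aux_X_supp _ _ (by simp [h])
  have hdet : Z.det = Z.adjugate o o * MvPolynomial.X (o, o)
      + (Z.updateRow o (Function.update (Z o) o 0)).det := by
    rw [adjugate_apply, mul_comm, ← det_updateRow_smul, ← det_updateRow_add]
    congr 1
    ext1 a b
    by_cases h : a = o
    · subst h
      by_cases hb : b = a
      · subst hb; simp [hZ]
      · simp [hb]
    · simp [h]
  have hr : (o, o) ∉ ((Z.updateRow o (Function.update (Z o) o 0)).det).vars := by
    apply aux_notMem
    apply aux_det_vars
    intro a b
    by_cases h : a = o
    · subst h
      by_cases hb : b = a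
      · subst hb; simp
      · simp only [updateRow_self, Function.update_of_ne hb]
        exact aux_X_supp _ _ (by simp [hb])
    · rw [updateRow_ne h]
      exact aux_X_supp _ _ (by simp [h])
  rw [hdet]
  refine MvPolynomial.irreducible_mul_X_add _ _ _ (hne o) (hrow o o) hr ?_
  intro d hd1 hd2
  have hd : d ∣ Z.det := by rw [hdet]; exact dvd_add (hd1.mul_right _) hd2
  have hdc : ∀ k, (k, o) ∉ d.vars := fun k => aux_notMem_dvd _ _ _ (hne o) hd1 (hcol o k)
  have hdi : ∀ i, d ∣ Z.adjugate o i := by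
    intro i
    let φ : MvPolynomial (N × N) S →+* MvPolynomial (N × N) S :=
      MvPolynomial.eval₂Hom MvPolynomial.C (fun p => (Z.updateCol o (Pi.single i 1)) p.1 p.2)
    have h1 : φ d = d := by
      have : φ d = RingHom.id _ d := by
        apply MvPolynomial.hom_congr_vars _ _ rfl
        · ext x <;> simp [φ]
        · rintro ⟨a, b⟩ hv _
          have : b ≠ o := by rintro rfl; exact hdc _ hv
          simp [φ, this, hZ]
      simpa using this
    have h2 : φ Z.det = Z.adjugate o i := by
      rw [hcolE, RingHom.map_det]
      congr 1
      exact mvPolynomialX_map_eval₂ _ _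
    rw [← h1, ← h2]
    exact map_dvd φ hd
  have hdv : d.vars = ∅ := by
    ext ⟨i, l⟩
    simp only [Finset.notMem_empty, iff_false]
    exact aux_notMem_dvd _ _ _ (hne i) (hdi i) (hrow i l)
  rw [MvPolynomial.vars_eq_empty_iff_eq_C] at hdv
  have h1 := map_dvd (MvPolynomial.eval fun p : N × N => (1 : Matrix N N S) p.1 p.2) hd
  rw [RingHom.map_det, hZ, mvPolynomialX_mapMatrix_eval, det_one, hdv, MvPolynomial.eval_C] at h1
  rw [hdv]
  exact (isUnit_of_dvd_one h1).map MvPolynomial.C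

theorem aux_CB {K : Type*} [CommRing K] {N m : ℕ} (P Q : Matrix (Fin m) (Fin N) K) :
    (P * Qᵀ).det = ∑ S : {s : Finset (Fin N) // s.card = m},
      (P.submatrix id (S.1.orderEmbOfFin S.2)).det * (Q.submatrix id (S.1.orderEmbOfFin S.2)).det := by
  classical
  -- expansion over all functions
  have h1 : (P * Qᵀ).det = ∑ g : Fin m → Fin N, (P.submatrix id g).det * ∏ i, Q i (g i) := by
    simp only [det_apply', mul_apply, Finset.prod_univ_sum, Finset.mul_sum, Finset.sum_mul,
      Fintype.piFinset_univ, submatrix_apply, id, transpose_apply]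
    rw [Finset.sum_comm]
    refine Finset.sum_congr rfl fun g _ => Finset.sum_congr rfl fun σ _ => ?_
    rw [Finset.prod_mul_distrib, mul_assoc]
  have h2 : ∀ g : Fin m → Fin N, ¬ Function.Injective g → (P.submatrix id g).det = 0 := by
    intro g hg
    simp only [Function.Injective, not_forall] at hg
    obtain ⟨a, b, hab, hne⟩ := hg
    exact det_zero_of_column_eq hne (fun k => by simp [hab])
  rw [h1, ← Finset.sum_filter_add_sum_filter_not univ (fun g : Fin m → Fin N => Function.Injective g),
    Finset.sum_eq_zero (s := {g | ¬ Function.Injective g})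
      (fun g hg => by rw [h2 g (by simpa using hg), zero_mul]), add_zero]
  have h3 : ∀ S : {s : Finset (Fin N) // s.card = m},
      (P.submatrix id (S.1.orderEmbOfFin S.2)).det * (Q.submatrix id (S.1.orderEmbOfFin S.2)).det
      = ∑ σ : Equiv.Perm (Fin m), (P.submatrix id (S.1.orderEmbOfFin S.2 ∘ σ)).det *
        ∏ i, Q i (S.1.orderEmbOfFin S.2 (σ i)) := by
    intro S
    rw [← det_transpose (Q.submatrix id _), det_apply' (Q.submatrix id _)ᵀ, Finset.mul_sum]
    refine Finset.sum_congr rfl fun σ _ => ?_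
    have := det_permute' σ (P.submatrix id (S.1.orderEmbOfFin S.2))
    rw [submatrix_submatrix] at this
    rw [show (id ∘ id : Fin m → Fin m) = id from rfl] at this
    rw [this]
    simp only [transpose_apply, submatrix_apply, id]
    ring
  simp_rw [h3]
  have h4 := Fintype.sum_sigma
    (fun x : (Σ _ : {s : Finset (Fin N) // s.card = m}, Equiv.Perm (Fin m)) =>
      (P.submatrix id (x.1.1.orderEmbOfFin x.1.2 ∘ x.2)).det *
        ∏ i, Q i (x.1.1.orderEmbOfFin x.1.2 (x.2 i)))
  refine Eq.trans ?_ h4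
  symm
  have himg : ∀ (S : {s : Finset (Fin N) // s.card = m}) (σ : Equiv.Perm (Fin m)),
      univ.image (S.1.orderEmbOfFin S.2 ∘ σ) = S.1 := by
    intro S σ
    ext x
    have : x ∈ S.1 ↔ x ∈ Set.range (S.1.orderEmbOfFin S.2) := by
      rw [Finset.range_orderEmbOfFin]; rfl
    rw [this]
    simp only [mem_image, mem_univ, true_and, Function.comp, Set.mem_range]
    exact ⟨fun ⟨a, h⟩ => ⟨_, h⟩, fun ⟨a, h⟩ => ⟨σ.symm a, by simpa using h⟩⟩
  refine Finset.sum_bij (fun x _ => x.1.1.orderEmbOfFin x.1.2 ∘ x.2) ?_ ?_ ?_ ?_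
  · rintro ⟨S, σ⟩ _
    simpa using (S.1.orderEmbOfFin S.2).injective.comp σ.injective
  · rintro ⟨S, σ⟩ _ ⟨T, τ⟩ _ h
    simp only at h
    have hST : S = T := by
      apply Subtype.ext
      rw [← himg S σ, ← himg T τ, h]
    subst hST
    have : σ = τ := by
      ext i
      have := congrFun h i
      simp only [Function.comp] at this
      rw [(S.1.orderEmbOfFin S.2).injective this]
    rw [this]
  · intro g hg
    have hg : Function.Injective g := by simpa using hg
    let S : {s : Finset (Fin N) // s.card = m} :=
      ⟨univ.image g, by rw [card_image_of_injective _ hg]; simp⟩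
    have hmem : ∀ i, ∃ j, S.1.orderEmbOfFin S.2 j = g i := by
      intro i
      have : g i ∈ Set.range (S.1.orderEmbOfFin S.2) := by
        rw [Finset.range_orderEmbOfFin]; simp [S]
      exact this
    choose f hf using hmem
    have hfi : Function.Injective f := fun a b h => hg (by rw [← hf, ← hf, h])
    refine ⟨⟨S, Equiv.ofBijective f (Finite.injective_iff_bijective.1 hfi)⟩, by simp, ?_⟩
    funext i
    exact hf i
  · intro x _
    rfl

theorem aux_plus_inj {n : ℕ} (I J : Finset (Fin n)) (h : I.plus = J.plus) : I = J := by
  ext x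
  have := Finset.ext_iff.1 h x.castSucc
  simpa [Finset.plus, (Fin.castSucc_lt_last x).ne] using this

theorem aux_last_mem {n : ℕ} (I : Finset (Fin n)) : Fin.last n ∈ I.plus := by
  simp [Finset.plus]

theorem aux_plus_surj {n k : ℕ} (S : Finset (Fin (n + 1))) (hS : S.card = k + 1)
    (hl : Fin.last n ∈ S) : ∃ J : Finset (Fin n), J.card = k ∧ J.plus = S := by
  have hp : (univ.filter (fun x : Fin n => x.castSucc ∈ S)).plus = S := by
    ext x
    refine Fin.lastCases ?_ (fun y => ?_) x
    · simp [Finset.plus, hl]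
    · simp [Finset.plus, (Fin.castSucc_lt_last y).ne]
  refine ⟨_, ?_, hp⟩
  have := Finset.plus_card (I := univ.filter (fun x : Fin n => x.castSucc ∈ S)) rfl
  rw [hp] at this
  omega

theorem aux_prod_plus {K : Type*} [CommRing K] {n : ℕ} (J : Finset (Fin n)) (d : Fin (n + 1) → K) :
    ∏ j ∈ J.plus, d j = (∏ j ∈ J, d j.castSucc) * d (Fin.last n) := by
  unfold Finset.plus
  rw [Finset.prod_union, Finset.prod_image, Finset.prod_singleton]
  · intro a _ b _ h; exact Fin.castSucc_injective n h
  · simp [(Fin.castSucc_lt_last _).ne]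

theorem aux_CBd {K : Type*} [CommRing K] {N m : ℕ} (P Q : Matrix (Fin m) (Fin N) K)
    (d : Fin N → K) :
    (Matrix.of fun b a => ∑ j, P a j * d j * Q b j).det =
      ∑ S : {s : Finset (Fin N) // s.card = m}, (∏ j ∈ S.1, d j) *
      ((P.submatrix id (S.1.orderEmbOfFin S.2)).det *
        (Q.submatrix id (S.1.orderEmbOfFin S.2)).det) := by
  have h := aux_CB (Matrix.of fun a j => d j * P a j) Q
  rw [← det_transpose] at h
  have e : ((Matrix.of fun a j => d j * P a j) * Qᵀ)ᵀ =
      (Matrix.of fun b a => ∑ j, P a j * d j * Q b j) := by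
    ext b a
    simp [mul_apply, mul_comm (d _)]
  rw [← e, h]
  refine Finset.sum_congr rfl fun S _ => ?_
  have : (Matrix.of fun a j => d j * P a j).submatrix id (S.1.orderEmbOfFin S.2) =
      Matrix.of fun a j => (fun j => d (S.1.orderEmbOfFin S.2 j)) j *
        (P.submatrix id (S.1.orderEmbOfFin S.2)) a j := rfl
  rw [this, det_mul_row, mul_assoc]
  congr 1
  conv_rhs => rw [← Finset.map_orderEmbOfFin_univ S.1 S.2, Finset.prod_map]
  rfl

theorem aux_restricted {K : Type*} [CommRing K] {n k : ℕ}
    (A B : Matrix (Fin (n + 1)) (Fin (n + 1)) K) (I : {s : Finset (Fin n) // s.card = k})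
    (d : Fin (n + 1) → K) (hd : d (Fin.last n) = 1) :
    ∑ J : {s : Finset (Fin n) // s.card = k},
      minorPlus A I J * minorPlus B I J * ∏ j ∈ J.1, d j.castSucc =
    (Matrix.of fun b a : Fin (k + 1) => ∑ j,
      A (I.1.plus.orderEmbOfFin (Finset.plus_card I.2) a) j * d j *
        B (I.1.plus.orderEmbOfFin (Finset.plus_card I.2) b) j).det -
    (Matrix.of fun b a : Fin (k + 1) => ∑ j,
      A (I.1.plus.orderEmbOfFin (Finset.plus_card I.2) a) j *
        (Function.update d (Fin.last n) 0) j *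
        B (I.1.plus.orderEmbOfFin (Finset.plus_card I.2) b) j).det := by
  set e := I.1.plus.orderEmbOfFin (Finset.plus_card I.2) with he
  have h1 := aux_CBd (A.submatrix e id) (B.submatrix e id) d
  have h2 := aux_CBd (A.submatrix e id) (B.submatrix e id) (Function.update d (Fin.last n) 0)
  simp only [submatrix_apply, id] at h1 h2
  rw [h1, h2, ← Finset.sum_sub_distrib]
  have h3 : ∀ S : {s : Finset (Fin (n + 1)) // s.card = k + 1}, Fin.last n ∉ S.1 →
      ∏ j ∈ S.1, Function.update d (Fin.last n) 0 j = ∏ j ∈ S.1, d j := by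
    intro S hS
    refine Finset.prod_congr rfl fun j hj => ?_
    rw [Function.update_of_ne]
    rintro rfl; exact hS hj
  have h4 : ∀ S : {s : Finset (Fin (n + 1)) // s.card = k + 1}, Fin.last n ∈ S.1 →
      ∏ j ∈ S.1, Function.update d (Fin.last n) 0 j = 0 := by
    intro S hS
    exact Finset.prod_eq_zero hS (by simp)
  refine Finset.sum_of_injOn (fun J => ⟨J.1.plus, Finset.plus_card J.2⟩) ?_ ?_ ?_ ?_
  · intro J _ J' _ h
    exact Subtype.ext (aux_plus_inj _ _ (congrArg Subtype.val h))
  · intro J _; simp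
  · intro S _ hS
    rw [h3, sub_self]
    intro hl
    obtain ⟨J, hJ, hJS⟩ := aux_plus_surj S.1 S.2 hl
    exact hS ⟨⟨J, hJ⟩, by simp, Subtype.ext hJS⟩
  · intro J _
    rw [h4 _ (aux_last_mem _)]
    simp only [aux_prod_plus, hd]
    rw [zero_mul, sub_zero, mul_one, mul_comm]
    rfl

theorem aux_field {K : Type*} [Field K] {n k : ℕ} (hk : k ≤ n)
    (A B : Matrix (Fin (n + 1)) (Fin (n + 1)) K)
    (hB : B (Fin.last n) (Fin.last n) = 0)
    (hv : ∀ j : Fin n, B (Fin.last n) j.castSucc ≠ 0)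
    (y : Fin (n + 1) → K) (hy : ∀ j, y j ≠ 0) (hA : A *ᵥ y = 0) :
    (Matrix.of fun I J : {s : Finset (Fin n) // s.card = k} =>
      minorPlus A I J * minorPlus B I J).det = 0 := by
  let d : Fin (n + 1) → K :=
    Fin.lastCases (motive := fun _ => K) 1 (fun j => y j.castSucc / B (Fin.last n) j.castSucc)
  have hdl : d (Fin.last n) = 1 := by simp [d]
  have hdc : ∀ j : Fin n, d j.castSucc = y j.castSucc / B (Fin.last n) j.castSucc := by
    intro j; simp [d]
  rw [← exists_mulVec_eq_zero_iff]
  refine ⟨fun J => ∏ j ∈ J.1, d j.castSucc, ?_, ?_⟩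
  · obtain ⟨s, -, hs⟩ := Finset.exists_subset_card_eq (s := (univ : Finset (Fin n))) (n := k) (by simpa)
    intro h
    have := congrFun h ⟨s, hs⟩
    simp only [Pi.zero_apply, Finset.prod_eq_zero_iff] at this
    obtain ⟨j, -, hj⟩ := this
    rw [hdc] at hj
    exact div_ne_zero (hy _) (hv _) hj
  · ext I
    simp only [mulVec, dotProduct, of_apply, Pi.zero_apply]
    rw [aux_restricted A B I d hdl, sub_eq_zero]
    set e := I.1.plus.orderEmbOfFin (Finset.plus_card I.2) with he
    obtain ⟨r, hr⟩ : ∃ r, e r = Fin.last n := by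
      have : Fin.last n ∈ Set.range e := by
        rw [he, Finset.range_orderEmbOfFin]; exact aux_last_mem _
      exact this
    refine det_eq_of_forall_row_eq_smul_add_const
      (fun b => - B (e b) (Fin.last n) / y (Fin.last n)) r (by simp [hr, hB]) ?_
    intro b a
    have hAy := congrFun hA (e a)
    simp only [mulVec, dotProduct, Pi.zero_apply, Fin.sum_univ_castSucc] at hAy
    simp only [of_apply, Fin.sum_univ_castSucc, hr, hB, hdl, Function.update_self,
      Function.update_of_ne (Fin.castSucc_lt_last _).ne, mul_zero, zero_mul, add_zero, mul_one]
    have h5 : ∑ x : Fin n, A (e a) x.castSucc * d x.castSucc * B (Fin.last n) x.castSucc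
        = - (A (e a) (Fin.last n) * y (Fin.last n)) := by
      rw [← eq_neg_of_add_eq_zero_left hAy]
      refine Finset.sum_congr rfl fun x _ => ?_
      rw [hdc, mul_assoc, div_mul_cancel₀ _ (hv x)]
    rw [h5]
    have := hy (Fin.last n)
    field_simp

theorem aux_map {R K : Type*} [CommRing R] [CommRing K] (f : R →+* K) {n k : ℕ}
    (A : Matrix (Fin (n + 1)) (Fin (n + 1)) R) (I J : {s : Finset (Fin n) // s.card = k}) :
    f (minorPlus A I J) = minorPlus (A.map f) I J := by
  unfold minorPlus
  rw [RingHom.map_det]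
  rfl

theorem aux_mapW {R K : Type*} [CommRing R] [CommRing K] (f : R →+* K) {n k : ℕ}
    (A B : Matrix (Fin (n + 1)) (Fin (n + 1)) R) :
    f (Matrix.of fun I J : {s : Finset (Fin n) // s.card = k} =>
      minorPlus A I J * minorPlus B I J).det =
    (Matrix.of fun I J : {s : Finset (Fin n) // s.card = k} =>
      minorPlus (A.map f) I J * minorPlus (B.map f) I J).det := by
  rw [RingHom.map_det]
  congr 1
  ext I J
  simp [aux_map]

theorem aux_prime_field {R : Type} [CommRing R] (p : R) (hp : Prime p) :
    ∃ (F : Type) (_ : Field F) (ψ : R →+* F), ∀ x, ψ x = 0 ↔ p ∣ x := by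
  have hP : (Ideal.span {p}).IsPrime := (Ideal.span_singleton_prime hp.ne_zero).2 hp
  refine ⟨FractionRing (R ⧸ Ideal.span {p}), inferInstance,
    (algebraMap (R ⧸ Ideal.span {p}) (FractionRing (R ⧸ Ideal.span {p}))).comp
      (Ideal.Quotient.mk (Ideal.span {p})), fun x => ?_⟩
  rw [← Ideal.mem_span_singleton, ← Ideal.Quotient.eq_zero_iff_mem]
  exact (IsFractionRing.injective (R ⧸ Ideal.span {p}) (FractionRing (R ⧸ Ideal.span {p}))).eq_iff'
    (map_zero _)

theorem aux_generic (n k : ℕ) (hk : k ≤ n) :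
    (mvPolynomialX (Fin (n + 1)) (Fin (n + 1))
      (MvPolynomial (Fin (n + 1) × Fin (n + 1)) ℤ)).det ∣
    (Matrix.of fun I J : {s : Finset (Fin n) // s.card = k} =>
      minorPlus (mvPolynomialX (Fin (n + 1)) (Fin (n + 1))
        (MvPolynomial (Fin (n + 1) × Fin (n + 1)) ℤ)) I J *
      minorPlus (Matrix.of fun i j : Fin (n + 1) => if i = Fin.last n ∧ j = Fin.last n then 0 else
        (MvPolynomial.C (MvPolynomial.X (i, j)) : MvPolynomial (Fin (n + 1) × Fin (n + 1))
          (MvPolynomial (Fin (n + 1) × Fin (n + 1)) ℤ))) I J).det := by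
  set S := MvPolynomial (Fin (n + 1) × Fin (n + 1)) ℤ with hS
  set Z := mvPolynomialX (Fin (n + 1)) (Fin (n + 1)) S with hZ
  have hprime : Prime Z.det := (aux_irred (S := S) (Fin.last n)).prime
  obtain ⟨F, _, ψ, hψ⟩ := aux_prime_field Z.det hprime
  rw [← hψ, aux_mapW]
  refine aux_field hk _ _ ?_ ?_ (fun j => ψ (Z.adjugate j (Fin.last n))) ?_ ?_
  · simp
  · intro j
    simp only [map_apply, of_apply, (Fin.castSucc_lt_last j).ne, and_false, if_false]
    rw [Ne, hψ]
    intro h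
    have h2 := map_dvd (MvPolynomial.eval fun p => (0 : Matrix (Fin (n + 1)) (Fin (n + 1)) S) p.1 p.2) h
    rw [RingHom.map_det, mvPolynomialX_mapMatrix_eval, det_zero, MvPolynomial.eval_C,
      zero_dvd_iff] at h2
    exact MvPolynomial.X_ne_zero _ h2
  · intro j
    rw [Ne, hψ]
    exact aux_adj_ne _ _
  · ext i
    have := congrFun (congrFun (mul_adjugate Z) i) (Fin.last n)
    have h2 := congrArg ψ this
    rw [mul_apply, map_sum, Matrix.smul_apply, smul_eq_mul, map_mul, (hψ _).2 dvd_rfl, zero_mul] at h2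
    simpa [mulVec, dotProduct] using h2

theorem double_sylvester_B0 {K : Type*} [CommRing K] (n : ℕ) (k : ℕ) (hk : k ≤ n)
    (A B : Matrix (Fin (n + 1)) (Fin (n + 1)) K)
    (hB : B (Fin.last n) (Fin.last n) = 0)
    (W : Matrix {s : Finset (Fin n) // s.card = k} {s : Finset (Fin n) // s.card = k} K)
    (hW : ∀ I J, W I J = minorPlus A I J * minorPlus B I J) :
    A.det ∣ W.det := by
  have hWe : W = Matrix.of fun I J => minorPlus A I J * minorPlus B I J := by
    ext I J; exact hW I J
  let φ := MvPolynomial.eval₂Hom (MvPolynomial.eval₂Hom (Int.castRingHom K)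
    (fun p : Fin (n + 1) × Fin (n + 1) => B p.1 p.2))
    (fun p : Fin (n + 1) × Fin (n + 1) => A p.1 p.2)
  have h := map_dvd φ (aux_generic n k hk)
  rw [aux_mapW, RingHom.map_det] at h
  have e1 : (mvPolynomialX (Fin (n + 1)) (Fin (n + 1))
      (MvPolynomial (Fin (n + 1) × Fin (n + 1)) ℤ)).map φ = A := mvPolynomialX_map_eval₂ _ _
  rw [RingHom.mapMatrix_apply, e1] at h
  convert h using 1
  rw [hWe]
  congr 4
  ext I J
  congr 2
  ext i j
  simp only [map_apply, of_apply]
  split_ifs with hij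
  · rw [hij.1, hij.2, hB, map_zero]
  · simp [φ]
end

section
/- Let K be a commutative ring, n a nonnegative integer, and k in {0,1,...,n}. Let A = (a_{i,j}) and B = (b_{i,j}) be (n+1)×(n+1) matrices over K with a_{n+1,n+1} = 0 and b_{n+1,n+1} = 0. Let W be the matrix indexed by k-element subsets of {1,...,n} whose (I,J)-entry is det(sub_{I+}^{J+} A) · det(sub_{I+}^{J+} B). Then (det A)(det B) divides det W in K. -/
open Matrix Finset

namespace DS

/-- Minor on all rows and the columns in `S`. -/
noncomputable def mnr {R : Type*} [CommRing R] {m N : ℕ} (M : Matrix (Fin m) (Fin N) R)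
    (S : {s : Finset (Fin N) // s.card = m}) : R :=
  Matrix.det (Matrix.of fun a b : Fin m => M a (S.1.orderEmbOfFin S.2 b))

theorem cauchyBinet {R : Type*} [CommRing R] {m N : ℕ} (a b : Matrix (Fin m) (Fin N) R) :
    (a * b.transpose).det = ∑ S, mnr a S * mnr b S := by
  have h1 : (a * b.transpose).det =
      ∑ f : Fin m → Fin N, (Matrix.of fun i j => a i (f j)).det * ∏ i, b i (f i) := by
    simp only [Matrix.det_apply', Matrix.mul_apply, Finset.prod_univ_sum, Finset.mul_sum,
      Fintype.piFinset_univ, Finset.sum_mul, Matrix.transpose_apply, Matrix.of_apply,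
      Finset.prod_mul_distrib]
    rw [Finset.sum_comm]
    simp only [mul_assoc]
  have h2 : ∀ S : {s : Finset (Fin N) // s.card = m}, mnr a S * mnr b S =
      ∑ τ : Equiv.Perm (Fin m), (Matrix.of fun i j => a i (S.1.orderEmbOfFin S.2 (τ j))).det *
        ∏ i, b i (S.1.orderEmbOfFin S.2 (τ i)) := by
    intro S
    have h3 : ∀ τ : Equiv.Perm (Fin m),
        (Matrix.of fun i j => a i (S.1.orderEmbOfFin S.2 (τ j))).det =
          Equiv.Perm.sign τ * mnr a S := by
      intro τ
      exact Matrix.det_permute' τ (Matrix.of fun i j => a i (S.1.orderEmbOfFin S.2 j))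
    have h4 : mnr b S = ∑ τ : Equiv.Perm (Fin m),
        Equiv.Perm.sign τ * ∏ i, b i (S.1.orderEmbOfFin S.2 (τ i)) := by
      unfold mnr
      rw [← Matrix.det_transpose, Matrix.det_apply']
      rfl
    rw [h4, Finset.mul_sum]
    refine Finset.sum_congr rfl fun τ _ => ?_
    rw [h3]; ring
  rw [h1]
  simp only [h2]
  rw [← Fintype.sum_sigma']
  symm
  refine Finset.sum_of_injOn
    (fun x : (Σ _ : {s : Finset (Fin N) // s.card = m}, Equiv.Perm (Fin m)) =>
      fun j => x.1.1.orderEmbOfFin x.1.2 (x.2 j)) ?_ (fun _ _ => by simp) ?_ (fun _ _ => rfl)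
  · rintro ⟨S, τ⟩ - ⟨S', τ'⟩ - h
    simp only at h
    have hS : S = S' := by
      apply Subtype.ext
      apply Finset.coe_injective
      rw [← Finset.range_orderEmbOfFin S.1 S.2, ← Finset.range_orderEmbOfFin S'.1 S'.2,
        ← τ.surjective.range_comp (S.1.orderEmbOfFin S.2),
        ← τ'.surjective.range_comp (S'.1.orderEmbOfFin S'.2)]
      exact congrArg Set.range h
    subst hS
    have : τ = τ' := by
      ext j
      have := (S.1.orderEmbOfFin S.2).injective (congrFun h j)
      rw [this]
    rw [this]
  · intro f _ hf
    by_cases hi : Function.Injective f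
    · exfalso
      apply hf
      have hc : (Finset.univ.image f).card = m := by
        rw [Finset.card_image_of_injective _ hi]; simp
      let e := (Finset.univ.image f).orderIsoOfFin hc
      let g : Fin m → Fin m := fun j => e.symm ⟨f j, by simp⟩
      have hg : Function.Injective g := by
        intro x y hxy
        apply hi
        simpa [g] using hxy
      refine ⟨⟨⟨_, hc⟩, Equiv.ofBijective g (Finite.injective_iff_bijective.mp hg)⟩, by simp, ?_⟩
      funext j
      simp only [Equiv.ofBijective_apply]
      rw [← Finset.coe_orderIsoOfFin_apply]
      simp [g, e]
    · have : ∃ i j, f i = f j ∧ i ≠ j := by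
        unfold Function.Injective at hi
        push Not at hi
        exact hi
      obtain ⟨i, j, hij, hne⟩ := this
      rw [Matrix.det_zero_of_column_eq hne (fun k => by simp [hij]), zero_mul]

theorem mnr_scale {R : Type*} [CommRing R] {m N : ℕ} (M : Matrix (Fin m) (Fin N) R)
    (x : Fin N → R) (S : {s : Finset (Fin N) // s.card = m}) :
    mnr (Matrix.of fun i s => x s * M i s) S = (∏ s ∈ S.1, x s) * mnr M S := by
  unfold mnr
  have : ∏ s ∈ S.1, x s = ∏ j, x (S.1.orderEmbOfFin S.2 j) := by
    conv_lhs => rw [← Finset.image_orderEmbOfFin_univ S.1 S.2]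
    rw [Finset.prod_image]
    intro a _ b _ h
    exact (S.1.orderEmbOfFin S.2).injective h
  rw [this, ← Matrix.det_mul_row]
  rfl

theorem plus_last {n k : ℕ} (I : Finset (Fin n)) (h : I.card = k) :
    I.plus.orderEmbOfFin (Finset.plus_card h) (Fin.last k) = Fin.last n := by
  have hm : Fin.last n ∈ I.plus := by simp [Finset.plus]
  have : Fin.last n ∈ Set.range (I.plus.orderEmbOfFin (Finset.plus_card h)) := by
    rw [Finset.range_orderEmbOfFin]; exact hm
  obtain ⟨j, hj⟩ := this
  apply le_antisymm (Fin.le_last _)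
  rw [← hj]
  exact (I.plus.orderEmbOfFin _).monotone (Fin.le_last j)

theorem plus_inj {n : ℕ} {I J : Finset (Fin n)} (h : I.plus = J.plus) : I = J := by
  ext x
  have := Finset.ext_iff.mp h x.castSucc
  simpa [Finset.plus, Fin.castSucc_ne_last] using this

/-- Sum over the column sets containing the last column. -/
theorem sum_plus {R : Type*} [CommRing R] {n k : ℕ} (a b : Matrix (Fin (k + 1)) (Fin (n + 1)) R) :
    ∑ J : {s : Finset (Fin n) // s.card = k},
      mnr a ⟨J.1.plus, Finset.plus_card J.2⟩ * mnr b ⟨J.1.plus, Finset.plus_card J.2⟩ =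
    (a * b.transpose).det -
      (a * (Matrix.of fun i s => if s = Fin.last n then 0 else b i s).transpose).det := by
  rw [cauchyBinet, cauchyBinet, ← Finset.sum_sub_distrib]
  refine Finset.sum_of_injOn (fun J => ⟨J.1.plus, Finset.plus_card J.2⟩) ?_ (fun _ _ => by simp) ?_ ?_
  · intro I _ J _ h
    exact Subtype.ext (plus_inj (congrArg Subtype.val h))
  · intro S _ hS
    have hl : Fin.last n ∉ S.1 := by
      intro hl
      apply hS
      have hp : (S.1.preimage Fin.castSucc (Fin.castSucc_injective n).injOn).plus = S.1 := by
        ext x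
        induction x using Fin.lastCases with
        | last => simp [Finset.plus, hl]
        | cast x => simp [Finset.plus, Fin.castSucc_ne_last]
      have hc : (S.1.preimage Fin.castSucc (Fin.castSucc_injective n).injOn).card = k := by
        have := Finset.plus_card (I := S.1.preimage Fin.castSucc (Fin.castSucc_injective n).injOn) rfl
        rw [hp, S.2] at this
        omega
      exact ⟨⟨_, hc⟩, by simp, Subtype.ext hp⟩
    have : mnr (Matrix.of fun i s => if s = Fin.last n then 0 else b i s) S = mnr b S := by
      unfold mnr
      congr 1
      ext i j
      have : S.1.orderEmbOfFin S.2 j ≠ Fin.last n := fun h =>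
        hl (h ▸ Finset.orderEmbOfFin_mem S.1 S.2 j)
      simp [this]
    rw [this, sub_self]
  · intro J _
    have : mnr (Matrix.of fun i s => if s = Fin.last n then 0 else b i s)
        ⟨J.1.plus, Finset.plus_card J.2⟩ = 0 := by
      unfold mnr
      apply Matrix.det_eq_zero_of_column_eq_zero (Fin.last k)
      intro i
      exact if_pos (plus_last J.1 J.2)
    rw [this, mul_zero, sub_zero]

/-- The matrix `W`. -/
noncomputable def Wm {R : Type*} [CommRing R] {n : ℕ} (k : ℕ)
    (A B : Matrix (Fin (n + 1)) (Fin (n + 1)) R) :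
    Matrix {s : Finset (Fin n) // s.card = k} {s : Finset (Fin n) // s.card = k} R :=
  Matrix.of fun I J => minorPlus A I J * minorPlus B I J

theorem field_case {F : Type*} [Field F] {n k : ℕ} (hk : k ≤ n)
    (A B : Matrix (Fin (n + 1)) (Fin (n + 1)) F) (x : Fin (n + 1) → F)
    (hx : ∀ s, x s ≠ 0) (hAx : A.mulVec x = 0)
    (hB : B (Fin.last n) (Fin.last n) = 0)
    (hq : ∀ j : Fin n, B (Fin.last n) j.castSucc ≠ 0) : (Wm k A B).det = 0 := by
  classical
  let Q : Fin (n + 1) → F := fun s => if s = Fin.last n then 1 else (B (Fin.last n) s)⁻¹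
  have hQ : ∀ s, Q s ≠ 0 := by
    intro s
    induction s using Fin.lastCases with
    | last => simp [Q]
    | cast s => simp [Q, hq, Fin.castSucc_ne_last]
  rw [← Matrix.exists_mulVec_eq_zero_iff]
  refine ⟨fun J => (∏ s ∈ J.1.plus, x s) * ∏ s ∈ J.1.plus, Q s, ?_, ?_⟩
  · obtain ⟨J, -, hJ⟩ := Finset.exists_subset_card_eq (s := (Finset.univ : Finset (Fin n)))
      (n := k) (by simpa using hk)
    intro h
    have := congrFun h ⟨J, hJ⟩
    simp only [Pi.zero_apply, mul_eq_zero, Finset.prod_eq_zero_iff] at this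
    rcases this with ⟨s, -, hs⟩ | ⟨s, -, hs⟩
    · exact hx s hs
    · exact hQ s hs
  · funext I
    let r : Fin (k + 1) → Fin (n + 1) := I.1.plus.orderEmbOfFin (Finset.plus_card I.2)
    have hr : r (Fin.last k) = Fin.last n := plus_last I.1 I.2
    let a : Matrix (Fin (k + 1)) (Fin (n + 1)) F :=
      Matrix.of fun i s => x s * (Matrix.of fun i s => A (r i) s) i s
    let b : Matrix (Fin (k + 1)) (Fin (n + 1)) F :=
      Matrix.of fun i s => Q s * (Matrix.of fun i s => B (r i) s) i s
    have key := sum_plus (k := k) a b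
    have e : (Wm k A B).mulVec (fun J => (∏ s ∈ J.1.plus, x s) * ∏ s ∈ J.1.plus, Q s) I =
        ∑ J : {s : Finset (Fin n) // s.card = k},
      mnr a ⟨J.1.plus, Finset.plus_card J.2⟩ * mnr b ⟨J.1.plus, Finset.plus_card J.2⟩ := by
      simp only [Matrix.mulVec, dotProduct]
      refine Finset.sum_congr rfl fun J _ => ?_
      simp only [a, b, mnr_scale]
      have h1 : ∀ M : Matrix (Fin (n + 1)) (Fin (n + 1)) F, minorPlus M I J =
        mnr (Matrix.of fun i s => M (r i) s) ⟨J.1.plus, Finset.plus_card J.2⟩ := fun M => rfl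
      simp only [Wm, Matrix.of_apply, h1]
      ring
    rw [e, key, Pi.zero_apply, sub_eq_zero]
    rw [← Matrix.det_transpose, ← Matrix.det_transpose (a * _)]
    refine Matrix.det_eq_of_forall_row_eq_smul_add_const (fun c => - b c (Fin.last n))
      (Fin.last k) ?_ ?_
    · simp [b, hr, hB]
    · intro c i
      have ha : ∑ s : Fin n, a i s.castSucc = - a i (Fin.last n) := by
        have := congrFun hAx (r i)
        simp only [Matrix.mulVec, dotProduct, Fin.sum_univ_castSucc, Pi.zero_apply] at this
        rw [eq_neg_iff_add_eq_zero, ← this]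
        simp [a, mul_comm]
      have hb : ∀ s : Fin n, b (Fin.last k) s.castSucc = 1 := by
        intro s
        simp [b, hr, Q, Fin.castSucc_ne_last, hq]
      simp only [Matrix.transpose_apply, Matrix.mul_apply, Fin.sum_univ_castSucc, Matrix.of_apply,
        Fin.castSucc_ne_last, if_false, hb, mul_one, ha, if_true]
      ring

end DS

namespace DS
open MvPolynomial

theorem det_mem_sub {R T : Type*} [CommRing R] [CommRing T] [Algebra R T] (U : Subalgebra R T)
    {m : ℕ} (M : Matrix (Fin m) (Fin m) T) (h : ∀ i j, M i j ∈ U) : M.det ∈ U := by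
  rw [Matrix.det_apply']
  refine U.sum_mem fun σ _ => U.mul_mem ?_ (U.prod_mem fun i _ => h _ _)
  exact U.intCast_mem _

theorem swap_row {R : Type*} [CommRing R] {m : ℕ} (p q : Fin m) :
    ((Equiv.swap p q).permMatrix R) p = Pi.single q 1 := by
  funext j
  simp [Equiv.Perm.permMatrix, PEquiv.toMatrix_apply, Pi.single_apply, eq_comm]

theorem isUnit_det_perm {R : Type*} [CommRing R] {m : ℕ} (τ : Equiv.Perm (Fin m)) :
    IsUnit (τ.permMatrix R).det := by
  rw [Matrix.det_permutation]
  exact ((Equiv.Perm.sign τ).isUnit).map (Int.castRingHom R)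

theorem irred_det {R σ : Type*} [CommRing R] [IsDomain R] (m : ℕ) :
    ∀ f : Fin (m + 1) × Fin (m + 1) → σ, Function.Injective f →
    Irreducible (Matrix.of fun i j => (X (f (i, j)) : MvPolynomial σ R)).det := by
  induction m with
  | zero =>
    intro f _
    rw [Matrix.det_fin_one]
    have h := irreducible_mul_X_add (1 : MvPolynomial σ R) 0 (f (0, 0)) one_ne_zero (by simp)
      (by simp) isRelPrime_one_left
    simpa using h
  | succ m ih =>
    intro f hf
    set M : Matrix (Fin (m + 2)) (Fin (m + 2)) (MvPolynomial σ R) :=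
      Matrix.of fun i j => (X (f (i, j)) : MvPolynomial σ R) with hM
    set P := (M.submatrix Fin.succ Fin.succ).det with hP
    set g := ∑ j : Fin (m + 1), (-1) ^ (j.succ : ℕ) * M 0 j.succ *
      (M.submatrix Fin.succ j.succ.succAbove).det with hg
    have hdet : M.det = P * X (f (0, 0)) + g := by
      rw [Matrix.det_succ_row_zero, Fin.sum_univ_succ]
      simp [hM, hP, hg, mul_comm]
    have hPi : Irreducible P :=
      ih (fun p => f (p.1.succ, p.2.succ)) (by
        rintro ⟨a, b⟩ ⟨c, d⟩ h
        have := hf h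
        simpa using this)
    have hsup : ∀ i j, (i, j) ≠ ((0 : Fin (m + 2)), (0 : Fin (m + 2))) →
        M i j ∈ supported R {s | s ≠ f (0, 0)} := by
      intro i j hij
      simp only [hM, Matrix.of_apply]
      refine Algebra.subset_adjoin ⟨f (i, j), ?_, rfl⟩
      exact fun h => hij (hf h)
    have hmin : ∀ c : Fin (m + 1) → Fin (m + 2),
        (M.submatrix Fin.succ c).det ∈ supported R {s | s ≠ f (0, 0)} := by
      intro c
      refine det_mem_sub _ _ fun i j => hsup _ _ ?_
      simp
    rw [hdet]
    refine irreducible_mul_X_add P g _ hPi.ne_zero ?_ ?_ ?_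
    · intro h
      exact (mem_supported.mp (hmin Fin.succ)) h rfl
    · intro h
      refine (mem_supported.mp (?_ : g ∈ supported R {s | s ≠ f (0, 0)})) h rfl
      refine Subalgebra.sum_mem _ fun j _ => Subalgebra.mul_mem _ (Subalgebra.mul_mem _ ?_ ?_) (hmin _)
      · exact Subalgebra.pow_mem _ (Subalgebra.neg_mem _ (Subalgebra.one_mem _)) _
      · exact hsup _ _ (by simp)
    · have hnd : ¬ P ∣ g := by
        intro hd
        let N : Matrix (Fin (m + 2)) (Fin (m + 2)) R := (Equiv.swap 0 1).permMatrix R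
        let φ : MvPolynomial σ R →+* R := eval (Function.extend f (fun p => N p.1 p.2) 0)
        have hφ : ∀ i j, φ (M i j) = N i j := by
          intro i j
          simp [φ, hM, hf.extend_apply]
        have hN1 : N 1 = Pi.single 0 1 := by
          have := swap_row (R := R) (1 : Fin (m + 2)) 0
          rwa [Equiv.swap_comm] at this
        have hN0 : N 0 = Pi.single 1 1 := swap_row (R := R) (0 : Fin (m + 2)) 1
        have hP0 : φ P = 0 := by
          rw [hP, RingHom.map_det]
          apply Matrix.det_eq_zero_of_row_eq_zero 0
          intro j
          simp only [RingHom.mapMatrix_apply, Matrix.map_apply, Matrix.submatrix_apply, hφ]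
          rw [Fin.succ_zero_eq_one, hN1]
          simp
        have hdd := congrArg φ hdet
        rw [map_add, map_mul, hP0, zero_mul, zero_add, RingHom.map_det] at hdd
        have hmm : φ.mapMatrix M = N := by
          ext i j
          exact hφ i j
        rw [hmm] at hdd
        have h0 : φ g = 0 := by
          have := map_dvd φ hd
          rwa [hP0, zero_dvd_iff] at this
        have hu := isUnit_det_perm (R := R) (Equiv.swap (0 : Fin (m + 2)) 1)
        change IsUnit N.det at hu
        rw [hdd, h0] at hu
        exact not_isUnit_zero hu
      intro c hc hcg
      obtain ⟨d, hd⟩ := hc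
      rcases hPi.isUnit_or_isUnit hd with h | h
      · exact h
      · exfalso
        apply hnd
        rw [hd]
        exact (h.mul_right_dvd).mpr hcg

theorem Wm_map {R T : Type*} [CommRing R] [CommRing T] (φ : R →+* T) {n k : ℕ}
    (A B : Matrix (Fin (n + 1)) (Fin (n + 1)) R) :
    φ (Wm k A B).det = (Wm k (A.map φ) (B.map φ)).det := by
  rw [RingHom.map_det]
  congr 1
  ext I J
  simp only [Wm, minorPlus, RingHom.mapMatrix_apply, Matrix.map_apply, Matrix.of_apply, map_mul,
    RingHom.map_det]
  rfl

theorem generic_case {S : Type*} [CommRing S] [IsDomain S] [UniqueFactorizationMonoid S]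
    {n k : ℕ} (hk : k ≤ n)
    (B : Matrix (Fin (n + 1)) (Fin (n + 1)) S)
    (hB : B (Fin.last n) (Fin.last n) = 0)
    (hq : ∀ j : Fin n, B (Fin.last n) j.castSucc ≠ 0) :
    (Matrix.mvPolynomialX (Fin (n + 1)) (Fin (n + 1)) S).det ∣
      (Wm k (Matrix.mvPolynomialX (Fin (n + 1)) (Fin (n + 1)) S) (B.map C)).det := by
  set A := Matrix.mvPolynomialX (Fin (n + 1)) (Fin (n + 1)) S with hA
  have hirr : Irreducible A.det := irred_det n id Function.injective_id
  have hpr : Prime A.det := hirr.prime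
  have hI : (Ideal.span {A.det}).IsPrime := (Ideal.span_singleton_prime hpr.ne_zero).mpr hpr
  let Q := MvPolynomial (Fin (n + 1) × Fin (n + 1)) S ⧸ Ideal.span {A.det}
  let ψ : MvPolynomial (Fin (n + 1) × Fin (n + 1)) S →+* FractionRing Q :=
    (algebraMap Q (FractionRing Q)).comp (Ideal.Quotient.mk _)
  have hψ : ∀ p, ψ p = 0 ↔ A.det ∣ p := by
    intro p
    simp only [ψ, RingHom.comp_apply]
    rw [IsFractionRing.to_map_eq_zero_iff, Ideal.Quotient.eq_zero_iff_mem,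
      Ideal.mem_span_singleton]
  rw [← hψ, Wm_map]
  have hev : ∀ N : Matrix (Fin (n + 1)) (Fin (n + 1)) S,
      (eval (fun p : Fin (n + 1) × Fin (n + 1) => N p.1 p.2)).mapMatrix A = N :=
    fun N => Matrix.mvPolynomialX_mapMatrix_eval N
  refine field_case hk _ _ (fun s => ψ (A.adjugate s (Fin.last n))) ?_ ?_ ?_ ?_
  · intro s h
    rw [hψ] at h
    let N : Matrix (Fin (n + 1)) (Fin (n + 1)) S :=
      ((Equiv.swap (Fin.last n) s).permMatrix S).updateRow (Fin.last n) 0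
    have := map_dvd (eval (fun p : Fin (n + 1) × Fin (n + 1) => N p.1 p.2)) h
    have hadj : eval (fun p : Fin (n + 1) × Fin (n + 1) => N p.1 p.2)
        (A.adjugate s (Fin.last n)) = N.adjugate s (Fin.last n) := by
      have h5 := RingHom.map_adjugate (eval (fun p : Fin (n + 1) × Fin (n + 1) => N p.1 p.2)) A
      rw [hev] at h5
      exact congrFun (congrFun h5 s) (Fin.last n)
    rw [RingHom.map_det, hev, hadj,
      Matrix.det_eq_zero_of_row_eq_zero (Fin.last n) (by intro j; simp [N]), zero_dvd_iff,
      Matrix.adjugate_apply] at this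
    have hu := isUnit_det_perm (R := S) (Equiv.swap (Fin.last n) s)
    rw [Matrix.updateRow_idem, ← swap_row, Matrix.updateRow_eq_self] at this
    rw [this] at hu
    exact not_isUnit_zero hu
  · funext i
    have h := congrFun (congrFun (Matrix.mul_adjugate A) i) (Fin.last n)
    have h2 := congrArg ψ h
    rw [Matrix.mul_apply, map_sum] at h2
    simp only [map_mul, Matrix.smul_apply, smul_eq_mul, (hψ A.det).mpr dvd_rfl, zero_mul] at h2
    exact h2
  · simp [hB]
  · intro j h
    simp only [Matrix.map_apply] at h
    rw [hψ] at h
    have := map_dvd (eval (fun p : Fin (n + 1) × Fin (n + 1) =>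
      (0 : Matrix (Fin (n + 1)) (Fin (n + 1)) S) p.1 p.2)) h
    rw [RingHom.map_det, hev, Matrix.det_zero, eval_C, zero_dvd_iff] at this
    exact hq j this

/-- Generic matrix with last corner entry zero. -/
noncomputable def gen0 (n : ℕ) (S : Type*) [CommRing S] :
    Matrix (Fin (n + 1)) (Fin (n + 1)) (MvPolynomial (Fin (n + 1) × Fin (n + 1)) S) :=
  Matrix.of fun i j => if i = Fin.last n ∧ j = Fin.last n then 0 else X (i, j)

theorem gen0_eval (n : ℕ) {S T : Type*} [CommRing S] [CommRing T] (f : S →+* T)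
    (N : Matrix (Fin (n + 1)) (Fin (n + 1)) T) (hN : N (Fin.last n) (Fin.last n) = 0) :
    (gen0 n S).map (eval₂Hom f (fun p => N p.1 p.2)) = N := by
  ext i j
  simp only [Matrix.map_apply, gen0, Matrix.of_apply]
  split_ifs with hij
  · simp [hij.1, hij.2, hN]
  · simp

theorem single_case {K : Type*} [CommRing K] {n k : ℕ} (hk : k ≤ n)
    (A B : Matrix (Fin (n + 1)) (Fin (n + 1)) K)
    (hB : B (Fin.last n) (Fin.last n) = 0) : A.det ∣ (Wm k A B).det := by
  let S := MvPolynomial (Fin (n + 1) × Fin (n + 1)) ℤ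
  let B' : Matrix (Fin (n + 1)) (Fin (n + 1)) S := gen0 n ℤ
  have h := generic_case hk B' (by simp [B', gen0]) (by
    intro j
    have : B' (Fin.last n) j.castSucc = (X (Fin.last n, j.castSucc) : MvPolynomial _ ℤ) := by
      simp [B', gen0, Fin.castSucc_ne_last]
    rw [this]
    exact X_ne_zero _)
  let φ : MvPolynomial (Fin (n + 1) × Fin (n + 1)) S →+* K :=
    eval₂Hom (eval₂Hom (Int.castRingHom K) (fun p => B p.1 p.2)) (fun p => A p.1 p.2)
  have h2 := map_dvd φ h
  rw [Wm_map, RingHom.map_det, RingHom.mapMatrix_apply] at h2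
  have e1 : (Matrix.mvPolynomialX (Fin (n + 1)) (Fin (n + 1)) S).map φ = A := by
    ext i j
    simp [φ]
  have e2 : (B'.map C).map φ = B := by
    refine Eq.trans ?_ (gen0_eval n (Int.castRingHom K) B hB)
    ext i j
    simp [B', φ]
    rfl
  rwa [e1, e2] at h2

theorem Wm_comm {R : Type*} [CommRing R] {n k : ℕ}
    (A B : Matrix (Fin (n + 1)) (Fin (n + 1)) R) : Wm k A B = Wm k B A := by
  ext I J
  simp [Wm, mul_comm]

theorem gen0_unit (n : ℕ) (S : Type*) [CommRing S] :
    ∃ φ : MvPolynomial (Fin (n + 2) × Fin (n + 2)) S →+* S, (∀ s, φ (C s) = s) ∧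
      IsUnit (φ (gen0 (n + 1) S).det) := by
  let N := (Equiv.swap (Fin.last (n + 1)) 0).permMatrix S
  refine ⟨eval₂Hom (RingHom.id S) (fun p => N p.1 p.2), by simp, ?_⟩
  rw [RingHom.map_det, RingHom.mapMatrix_apply, gen0_eval]
  · exact isUnit_det_perm _
  · change (Equiv.swap (Fin.last (n + 1)) 0).permMatrix S (Fin.last (n + 1)) (Fin.last (n + 1)) = 0
    rw [swap_row, Pi.single_apply, if_neg]
    exact (Fin.last_pos).ne'

theorem main {K : Type*} [CommRing K] {n k : ℕ} (hk : k ≤ n)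
    (A B : Matrix (Fin (n + 1)) (Fin (n + 1)) K)
    (hA : A (Fin.last n) (Fin.last n) = 0)
    (hB : B (Fin.last n) (Fin.last n) = 0) : A.det * B.det ∣ (Wm k A B).det := by
  cases n with
  | zero =>
    have h := single_case hk A B hB
    have h0 : A.det = 0 := by
      rw [Matrix.det_fin_one]; exact hA
    rw [h0, zero_dvd_iff] at h
    rw [h]
    exact dvd_zero _
  | succ n =>
    let S := MvPolynomial (Fin (n + 2) × Fin (n + 2)) ℤ
    let A' := gen0 (n + 1) S
    let B' := (gen0 (n + 1) ℤ).map (C : S →+* MvPolynomial (Fin (n + 2) × Fin (n + 2)) S)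
    have hA' : A' (Fin.last _) (Fin.last _) = 0 := by simp [A', gen0]
    have hB' : B' (Fin.last _) (Fin.last _) = 0 := by simp [B', gen0]
    have h1 : A'.det ∣ (Wm k A' B').det := single_case hk A' B' hB'
    have h2 : B'.det ∣ (Wm k A' B').det := by
      rw [Wm_comm]; exact single_case hk B' A' hA'
    have hd : B'.det = C (gen0 (n + 1) ℤ).det := by
      rw [RingHom.map_det]; rfl
    have hd0 : (gen0 (n + 1) ℤ).det ≠ 0 := by
      intro h
      obtain ⟨φ, -, hφ⟩ := gen0_unit n ℤ
      rw [h, map_zero] at hφ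
      exact not_isUnit_zero hφ
    have hrel : IsRelPrime A'.det B'.det := by
      intro c hcA hcB
      rw [hd, dvd_C_iff_exists hd0] at hcB
      obtain ⟨e, -, rfl⟩ := hcB
      obtain ⟨φ, hC, hφ⟩ := gen0_unit n S
      have := map_dvd φ hcA
      rw [hC] at this
      exact (isUnit_of_dvd_unit this hφ).map C
    have h3 := hrel.mul_dvd h1 h2
    have h4 := map_dvd (eval₂Hom (eval₂Hom (Int.castRingHom K) (fun p => B p.1 p.2))
      (fun p => A p.1 p.2)) h3
    rw [Wm_map, map_mul, RingHom.map_det, RingHom.map_det, RingHom.mapMatrix_apply,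
      RingHom.mapMatrix_apply] at h4
    have e1 : A'.map (eval₂Hom (eval₂Hom (Int.castRingHom K) (fun p => B p.1 p.2))
      (fun p => A p.1 p.2)) = A := gen0_eval _ _ _ hA
    have e2 : B'.map (eval₂Hom (eval₂Hom (Int.castRingHom K) (fun p => B p.1 p.2))
      (fun p => A p.1 p.2)) = B := by
      refine Eq.trans ?_ (gen0_eval (n + 1) (Int.castRingHom K) B hB)
      ext i j
      simp [B']
    rwa [e1, e2] at h4

end DS

theorem double_sylvester_AB0 {K : Type*} [CommRing K] (n : ℕ) (k : ℕ) (hk : k ≤ n)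
    (A B : Matrix (Fin (n + 1)) (Fin (n + 1)) K)
    (hA : A (Fin.last n) (Fin.last n) = 0)
    (hB : B (Fin.last n) (Fin.last n) = 0)
    (W : Matrix {s : Finset (Fin n) // s.card = k} {s : Finset (Fin n) // s.card = k} K)
    (hW : ∀ I J, W I J = minorPlus A I J * minorPlus B I J) :
    A.det * B.det ∣ W.det := by
  have : W = DS.Wm k A B := by
    ext I J
    exact hW I J
  rw [this]
  exact DS.main hk A B hA hB
end

section
/- Let K be a commutative ring, n a nonnegative integer, and k in {0,1,...,n}. Let A = (a_{i,j}) and B = (b_{i,j}) be (n+1)×(n+1) matrices over K such that b_{n+1,n+1} = 0 and a_{n+1,j} = 0 for all j in {1,...,n}. Let W be the matrix indexed by k-element subsets of {1,...,n} whose (I,J)-entry is det(sub_{I+}^{J+} A) · det(sub_{I+}^{J+} B). Then det A divides det W in K. -/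
open Matrix Finset

/-- For every positive `n` there is an `n × n` matrix with irreducible characteristic polynomial. -/
theorem exists_irred_charpoly (n : ℕ) (hn : n ≠ 0) :
    ∃ M : Matrix (Fin n) (Fin n) (ZMod 2), Irreducible M.charpoly := by
  have : Fact (Nat.Prime 2) := ⟨Nat.prime_two⟩
  let pb := Field.powerBasisOfFiniteOfSeparable (ZMod 2) (GaloisField 2 n)
  have hd : pb.dim = n := by rw [← pb.finrank, GaloisField.finrank 2 hn]
  have : ∃ M : Matrix (Fin pb.dim) (Fin pb.dim) (ZMod 2), Irreducible M.charpoly := by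
    refine ⟨Algebra.leftMulMatrix pb.basis pb.gen, ?_⟩
    rw [charpoly_leftMulMatrix]
    exact minpoly.irreducible (Algebra.IsIntegral.isIntegral _)
  rwa [hd] at this

/-- The index type of variables. -/
abbrev GenVar (n : ℕ) := (Fin n × Fin n) ⊕ (Fin (n + 1) × Fin (n + 1))

/-- The generic coefficient ring. -/
abbrev GenRing (n : ℕ) := Polynomial (MvPolynomial (GenVar n) ℤ)

/-- The generic matrix whose characteristic matrix is used. -/
noncomputable def genM (n : ℕ) : Matrix (Fin n) (Fin n) (MvPolynomial (GenVar n) ℤ) :=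
  Matrix.of fun i j => MvPolynomial.X (Sum.inl (i, j))

noncomputable def genA (n : ℕ) : Matrix (Fin n) (Fin n) (GenRing n) := (genM n).charmatrix

noncomputable def genB (n : ℕ) : Matrix (Fin (n + 1)) (Fin (n + 1)) (GenRing n) :=
  Matrix.of fun i j => if i = Fin.last n ∧ j = Fin.last n then 0 else
    Polynomial.C (MvPolynomial.X (Sum.inr (i, j)))

theorem gen_univ {L : Type*} [CommRing L] {n : ℕ} (A : Matrix (Fin n) (Fin n) L)
    (B : Matrix (Fin (n + 1)) (Fin (n + 1)) L) (hB : B (Fin.last n) (Fin.last n) = 0) :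
    ∃ φ : GenRing n →+* L, (∀ i j, φ (genA n i j) = A i j) ∧ ∀ i j, φ (genB n i j) = B i j := by
  refine ⟨Polynomial.eval₂RingHom (MvPolynomial.eval₂Hom (Int.castRingHom L)
    (Sum.elim (fun p => - A p.1 p.2) (fun p => B p.1 p.2))) 0, ?_, ?_⟩
  · intro i j
    by_cases h : i = j
    · subst h
      simp [genA, genM, charmatrix_apply_eq]
    · simp [genA, genM, charmatrix_apply_ne _ _ _ h]
  · intro i j
    simp only [genB, of_apply]
    split_ifs with h
    · rw [h.1, h.2, hB, map_zero]
    · simp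

theorem genA_prime (n : ℕ) (hn : n ≠ 0) : Prime (genA n).det := by
  have : Fact (Nat.Prime 2) := ⟨Nat.prime_two⟩
  obtain ⟨M, hM⟩ := exists_irred_charpoly n hn
  apply Irreducible.prime
  change Irreducible (genM n).charpoly
  refine Polynomial.Monic.irreducible_of_irreducible_map
    (MvPolynomial.eval₂Hom (Int.castRingHom (ZMod 2))
      (Sum.elim (fun p => M p.1 p.2) (fun _ => 0))) _ (charpoly_monic _) ?_
  rw [← charpoly_map]
  convert hM
  ext i j
  simp [genM]

theorem genA_adj (n : ℕ) (i j : Fin n) : ¬ (genA n).det ∣ (genA n).adjugate j i := by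
  intro h
  let P : Matrix (Fin n) (Fin n) ℤ := (Equiv.swap i j).permMatrix ℤ
  obtain ⟨φ, hφ, -⟩ := gen_univ (P.updateRow i 0) 0 rfl
  have hA : φ.mapMatrix (genA n) = P.updateRow i 0 := by ext a b; simp [hφ]
  have h2 := map_dvd φ h
  have e : φ ((genA n).adjugate j i) = (φ.mapMatrix (genA n)).adjugate j i := by
    rw [← RingHom.map_adjugate]; rfl
  rw [e, RingHom.map_det, hA, det_eq_zero_of_row_eq_zero i (by simp), zero_dvd_iff,
    adjugate_apply, updateRow_idem] at h2
  have : P.updateRow i (Pi.single j 1) = P := by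
    ext a b
    by_cases h : a = i
    · subst h
      simp [P, Equiv.Perm.permMatrix, PEquiv.toMatrix_apply, Pi.single_apply, eq_comm]
    · simp [updateRow_ne h]
  rw [this, det_permutation] at h2
  simp at h2

theorem genB_c (n : ℕ) (j : Fin n) : ¬ (genA n).det ∣ genB n (Fin.last n) j.castSucc := by
  intro h
  obtain ⟨φ, hφ, hφ2⟩ := gen_univ (0 : Matrix (Fin n) (Fin n) ℤ)
    (Matrix.of fun _ b => if b = j.castSucc then 1 else 0)
    (by simp [Fin.ext_iff, j.2.ne'])
  have hA : φ.mapMatrix (genA n) = 0 := by ext a b; simp [hφ]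
  have h2 := map_dvd φ h
  have : Nonempty (Fin n) := ⟨j⟩
  rw [RingHom.map_det, hA, hφ2, det_zero] at h2
  simp at h2

theorem plus_castSucc {n k : ℕ} (I : Finset (Fin n)) (h : I.card = k) :
    (fun a : Fin (k + 1) => ((I.plus.orderIsoOfFin (Finset.plus_card h)) a : Fin (n + 1))) =
      Fin.snoc (α := fun _ => Fin (n + 1)) (fun a => (I.orderEmbOfFin h a).castSucc) (Fin.last n) := by
  symm
  refine (Finset.orderEmbOfFin_unique (Finset.plus_card h) ?_ ?_)
  · intro x
    refine Fin.lastCases ?_ (fun a => ?_) x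
    · simp [Finset.plus]
    · simp [Finset.plus, Finset.orderEmbOfFin_mem]
  · intro x y
    refine Fin.lastCases ?_ (fun a => ?_) x
    · intro hxy
      exact absurd hxy (not_lt.2 (Fin.le_last y))
    · refine Fin.lastCases ?_ (fun b => ?_) y
      · simp [Fin.castSucc_lt_last]
      · simp

/-- Row and column selector. -/
def selP {n k : ℕ} (I : {s : Finset (Fin n) // s.card = k}) : Fin (k + 1) → Fin (n + 1) :=
  Fin.snoc (α := fun _ => Fin (n + 1)) (fun a => (I.1.orderEmbOfFin I.2 a).castSucc) (Fin.last n)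

def sel {n k : ℕ} (I : {s : Finset (Fin n) // s.card = k}) : Fin k → Fin n :=
  I.1.orderEmbOfFin I.2

theorem selP_last {n k : ℕ} (I : {s : Finset (Fin n) // s.card = k}) :
    selP I (Fin.last k) = Fin.last n := by simp [selP]

theorem selP_castSucc {n k : ℕ} (I : {s : Finset (Fin n) // s.card = k}) (a : Fin k) :
    selP I a.castSucc = (sel I a).castSucc := by simp [selP, sel]

theorem minorPlus_eq {K : Type*} [CommRing K] {n k : ℕ}
    (A : Matrix (Fin (n + 1)) (Fin (n + 1)) K)
    (I J : {s : Finset (Fin n) // s.card = k}) :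
    minorPlus A I J = (A.submatrix (selP I) (selP J)).det := by
  unfold minorPlus
  congr 1
  ext a b
  have h1 := congrFun (plus_castSucc I.1 I.2) a
  have h2 := congrFun (plus_castSucc J.1 J.2) b
  simp only [of_apply, submatrix_apply]
  rw [h1, h2]; rfl

theorem det_lastRow {K : Type*} [CommRing K] {k : ℕ} (A : Matrix (Fin (k + 1)) (Fin (k + 1)) K)
    (hA : ∀ j : Fin k, A (Fin.last k) j.castSucc = 0) :
    A.det = A (Fin.last k) (Fin.last k) * (A.submatrix Fin.castSucc Fin.castSucc).det := by
  rw [det_succ_row A (Fin.last k), Fin.sum_univ_castSucc]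
  simp [hA, ← two_mul, Fin.succAbove_last]

theorem minorPlus_lastRow {K : Type*} [CommRing K] {n k : ℕ}
    (A : Matrix (Fin (n + 1)) (Fin (n + 1)) K)
    (hA : ∀ j : Fin n, A (Fin.last n) j.castSucc = 0)
    (I J : {s : Finset (Fin n) // s.card = k}) :
    minorPlus A I J = A (Fin.last n) (Fin.last n) *
      ((A.submatrix Fin.castSucc Fin.castSucc).submatrix (sel I) (sel J)).det := by
  rw [minorPlus_eq, det_lastRow]
  · simp only [submatrix_apply, selP_last]
    congr 2
    ext a b
    simp [selP_castSucc]
  · intro j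
    simp [selP_castSucc, selP_last, hA]

/-- Cauchy-Binet. -/
theorem cauchy_binet {K : Type*} [CommRing K] {n k : ℕ}
    (M N : Matrix (Fin k) (Fin n) K) :
    ∑ J : {s : Finset (Fin n) // s.card = k},
      (M.submatrix id (sel J)).det * (N.submatrix id (sel J)).det = (M * Nᵀ).det := by
  have h1 : (M * Nᵀ).det = ∑ f : Fin k → Fin n, (M.submatrix id f).det * ∏ i, N i (f i) := by
    rw [det_apply']
    simp only [mul_apply, transpose_apply, Finset.prod_univ_sum, Fintype.piFinset_univ,
      Finset.mul_sum]
    rw [Finset.sum_comm]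
    refine Finset.sum_congr rfl fun f _ => ?_
    rw [det_apply', Finset.sum_mul]
    refine Finset.sum_congr rfl fun σ _ => ?_
    rw [Finset.prod_mul_distrib]
    simp [mul_assoc]
  have hr : ∀ J : {s : Finset (Fin n) // s.card = k}, Set.range (sel J) = (J.1 : Set (Fin n)) :=
    fun J => Finset.range_orderEmbOfFin J.1 J.2
  have hi : ∀ J : {s : Finset (Fin n) // s.card = k}, Function.Injective (sel J) :=
    fun J => (J.1.orderEmbOfFin J.2).injective
  have h2 : ∀ J : {s : Finset (Fin n) // s.card = k},
      (M.submatrix id (sel J)).det * (N.submatrix id (sel J)).det =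
      ∑ τ : Equiv.Perm (Fin k), (M.submatrix id (sel J ∘ τ)).det * ∏ i, N i ((sel J ∘ τ) i) := by
    intro J
    rw [← det_transpose (N.submatrix id (sel J)), det_apply' (N.submatrix id (sel J))ᵀ,
      Finset.mul_sum]
    refine Finset.sum_congr rfl fun τ _ => ?_
    have : (M.submatrix id (sel J ∘ τ)).det =
        (Equiv.Perm.sign τ : ℤ) * (M.submatrix id (sel J)).det := by
      rw [← det_permute', submatrix_submatrix]; rfl
    rw [this]
    simp only [transpose_apply, submatrix_apply, id, Function.comp]
    ring
  rw [h1, Finset.sum_congr rfl fun J _ => h2 J, ← Fintype.sum_prod_type']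
  refine Finset.sum_of_injOn
    (fun p : {s : Finset (Fin n) // s.card = k} × Equiv.Perm (Fin k) => sel p.1 ∘ p.2)
    ?_ (by simp) ?_ (fun _ _ => rfl)
  · rintro ⟨J, τ⟩ - ⟨J', τ'⟩ - h
    simp only at h
    have hJ : J = J' := by
      have := congrArg Set.range h
      rw [τ.surjective.range_comp, τ'.surjective.range_comp, hr, hr] at this
      exact Subtype.ext (Finset.coe_injective this)
    subst hJ
    congr 1
    ext i : 1
    exact hi J (congrFun h i)
  · intro f _ hf
    by_cases hinj : Function.Injective f
    · exfalso
      apply hf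
      let J : {s : Finset (Fin n) // s.card = k} :=
        ⟨Finset.univ.image f, by rw [Finset.card_image_of_injective _ hinj]; simp⟩
      have : ∀ i, ∃ a, sel J a = f i := by
        intro i
        have : f i ∈ Set.range (sel J) := by rw [hr]; simp [J]
        exact this
      choose τ hτ using this
      have hτi : Function.Injective τ := by
        intro a b hab
        apply hinj
        rw [← hτ, ← hτ, hab]
      refine ⟨(J, Equiv.ofBijective τ (Finite.injective_iff_bijective.1 hτi)), by simp, ?_⟩
      funext i
      exact hτ i
    · simp only [Function.Injective, not_forall] at hinj
      obtain ⟨a, b, hab, hne⟩ := hinj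
      rw [det_zero_of_column_eq hne (fun i => by simp [hab]), zero_mul]

theorem sum_kernel {K : Type*} [CommRing K] {n k : ℕ}
    (A : Matrix (Fin n) (Fin n) K) (B : Matrix (Fin (n + 1)) (Fin (n + 1)) K)
    (hB : B (Fin.last n) (Fin.last n) = 0) (x : Fin n → K) (d : K)
    (hx : ∀ i, d ∣ ∑ j, A i j * (x j * B (Fin.last n) j.castSucc))
    (I : {s : Finset (Fin n) // s.card = k}) :
    d ∣ ∑ J : {s : Finset (Fin n) // s.card = k},
      ((A.submatrix (sel I) (sel J)).det * minorPlus B I J) * ∏ a, x (sel J a) := by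
  have key : ∀ J : {s : Finset (Fin n) // s.card = k},
      ((A.submatrix (sel I) (sel J)).det * minorPlus B I J) * ∏ a, x (sel J a) =
      ∑ i : Fin k, ((-1) ^ ((i : ℕ) + k) * B (sel I i).castSucc (Fin.last n)) *
        (((A * diagonal x).submatrix (sel I) id).submatrix id (sel J)).det *
        (((B.submatrix (fun a => selP I (i.castSucc.succAbove a)) Fin.castSucc).submatrix
          id (sel J)).det) := by
    intro J
    have h1 : (((A * diagonal x).submatrix (sel I) id).submatrix id (sel J)).det =
        (∏ a, x (sel J a)) * (A.submatrix (sel I) (sel J)).det := by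
      rw [← det_mul_row]
      congr 1
      ext a b
      simp [mul_comm]
    rw [minorPlus_eq, det_succ_column _ (Fin.last k), Fin.sum_univ_castSucc, h1]
    simp only [submatrix_apply, selP_last, hB, mul_zero, zero_mul, add_zero]
    rw [Finset.mul_sum, Finset.sum_mul]
    refine Finset.sum_congr rfl fun i _ => ?_
    have h2 : ((B.submatrix (selP I) (selP J)).submatrix i.castSucc.succAbove
        (Fin.last k).succAbove) = ((B.submatrix (fun a => selP I (i.castSucc.succAbove a))
          Fin.castSucc).submatrix id (sel J)) := by
      ext a b
      simp [selP_castSucc, Fin.succAbove_last]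
    rw [h2, selP_castSucc]
    simp only [Fin.val_castSucc, Fin.val_last]
    ring
  rw [Finset.sum_congr rfl fun J _ => key J, Finset.sum_comm]
  refine Finset.dvd_sum fun i _ => ?_
  simp only [mul_assoc]
  rw [← Finset.mul_sum, ← Finset.mul_sum, cauchy_binet]
  refine Dvd.dvd.mul_left (Dvd.dvd.mul_left ?_ _) _
  obtain ⟨a0, ha0⟩ : ∃ a0, i.castSucc.succAbove a0 = Fin.last k :=
    Fin.exists_succAbove_eq (Fin.castSucc_lt_last i).ne'
  rw [det_apply]
  refine Finset.dvd_sum fun σ _ => ?_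
  rw [Units.smul_def, zsmul_eq_mul]
  refine Dvd.dvd.mul_left ?_ _
  refine dvd_trans ?_ (Finset.dvd_prod_of_mem _ (Finset.mem_univ a0))
  have := hx (sel I (σ a0))
  rw [mul_apply]
  simpa [ha0, selP_last, mul_assoc] using this

theorem det_dvd_generic {n : ℕ} (hn : n ≠ 0) (k : ℕ) (hk : k ≤ n) :
    (genA n).det ∣ (Matrix.of fun I J : {s : Finset (Fin n) // s.card = k} =>
      ((genA n).submatrix (sel I) (sel J)).det * minorPlus (genB n) I J).det := by
  set A := genA n with hA
  set B := genB n with hB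
  set W := (Matrix.of fun I J : {s : Finset (Fin n) // s.card = k} =>
      (A.submatrix (sel I) (sel J)).det * minorPlus B I J) with hW
  have hp : Prime A.det := genA_prime n hn
  let i0 : Fin n := ⟨0, Nat.pos_of_ne_zero hn⟩
  let x : Fin n → GenRing n := fun j =>
    A.adjugate j i0 * ∏ l ∈ (Finset.univ : Finset (Fin n)).erase j, B (Fin.last n) l.castSucc
  have hx : ∀ i, A.det ∣ ∑ j, A i j * (x j * B (Fin.last n) j.castSucc) := by
    intro i
    have : ∑ j, A i j * (x j * B (Fin.last n) j.castSucc) =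
        (A * A.adjugate) i i0 * ∏ l : Fin n, B (Fin.last n) l.castSucc := by
      rw [mul_apply, Finset.sum_mul]
      refine Finset.sum_congr rfl fun j _ => ?_
      rw [← Finset.prod_erase_mul _ _ (Finset.mem_univ j)]
      simp only [x]
      ring
    rw [this, mul_adjugate, Matrix.smul_apply, smul_eq_mul, mul_assoc]
    exact dvd_mul_right _ _
  have hxn : ∀ j, ¬ A.det ∣ x j := by
    intro j h
    rcases hp.dvd_or_dvd h with h | h
    · exact genA_adj n i0 j h
    · obtain ⟨l, -, hl⟩ := (hp.dvd_finsetProd_iff _).1 h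
      exact genB_c n l hl
  have hk0 : ∀ I, A.det ∣ (W *ᵥ fun J => ∏ a, x (sel J a)) I := by
    intro I
    exact sum_kernel A B (by simp [hB, genB]) x A.det hx I
  obtain ⟨s, -, hs⟩ := Finset.exists_subset_card_eq (s := (Finset.univ : Finset (Fin n)))
    (n := k) (by simpa using hk)
  let J0 : {s : Finset (Fin n) // s.card = k} := ⟨s, hs⟩
  have h3 : A.det ∣ (W.adjugate *ᵥ (W *ᵥ fun J => ∏ a, x (sel J a))) J0 := by
    rw [mulVec, dotProduct]
    exact Finset.dvd_sum fun I _ => Dvd.dvd.mul_left (hk0 I) _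
  rw [mulVec_mulVec, adjugate_mul, smul_mulVec, one_mulVec, Pi.smul_apply, smul_eq_mul] at h3
  rcases hp.dvd_or_dvd h3 with h | h
  · exact h
  · obtain ⟨a, -, ha⟩ := (hp.dvd_finsetProd_iff _).1 h
    exact absurd ha (hxn _)

theorem det_dvd_all {K : Type*} [CommRing K] {n : ℕ} (k : ℕ) (hk : k ≤ n)
    (A : Matrix (Fin n) (Fin n) K) (B : Matrix (Fin (n + 1)) (Fin (n + 1)) K)
    (hB : B (Fin.last n) (Fin.last n) = 0) :
    A.det ∣ (Matrix.of fun I J : {s : Finset (Fin n) // s.card = k} =>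
      (A.submatrix (sel I) (sel J)).det * minorPlus B I J).det := by
  rcases eq_or_ne n 0 with rfl | hn
  · simp
  obtain ⟨φ, h1, h2⟩ := gen_univ A B hB
  have := map_dvd φ (det_dvd_generic hn k hk)
  rw [RingHom.map_det, RingHom.map_det] at this
  convert this using 2
  · ext i j; simp [h1]
  · ext I J
    simp only [of_apply, RingHom.mapMatrix_apply, map_apply, map_mul, minorPlus_eq,
      RingHom.map_det]
    congr 2
    · ext i j; simp [h1]
    · ext i j; simp [h2]

theorem double_sylvester_lastRowZero {K : Type*} [CommRing K] (n : ℕ) (k : ℕ) (hk : k ≤ n)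
    (A B : Matrix (Fin (n + 1)) (Fin (n + 1)) K)
    (hB : B (Fin.last n) (Fin.last n) = 0)
    (hA : ∀ j : Fin n, A (Fin.last n) j.castSucc = 0)
    (W : Matrix {s : Finset (Fin n) // s.card = k} {s : Finset (Fin n) // s.card = k} K)
    (hW : ∀ I J, W I J = minorPlus A I J * minorPlus B I J) :
    A.det ∣ W.det := by
  have hWe : W = A (Fin.last n) (Fin.last n) •
      (Matrix.of fun I J : {s : Finset (Fin n) // s.card = k} =>
      ((A.submatrix Fin.castSucc Fin.castSucc).submatrix (sel I) (sel J)).det *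
        minorPlus B I J) := by
    ext I J
    rw [hW, minorPlus_lastRow A hA]
    simp [mul_assoc]
  rw [hWe, det_smul, det_lastRow A hA]
  refine mul_dvd_mul (dvd_pow_self _ ?_) (det_dvd_all k hk _ B hB)
  obtain ⟨s, -, hs⟩ := Finset.exists_subset_card_eq (s := (Finset.univ : Finset (Fin n)))
    (n := k) (by simpa using hk)
  haveI : Nonempty {s : Finset (Fin n) // s.card = k} := ⟨⟨s, hs⟩⟩
  exact Fintype.card_ne_zero
end

section
/- Let K be a commutative ring, n and k nonnegative integers with k ≤ n, and A = (a_{i,j}) an (n+1)×(n+1) matrix over K. Let W_A be the matrix indexed by k-element subsets of {1,...,n} whose (I,J)-entry is det(sub_{I+}^{J+} A). Then det(W_A) = a_{n+1,n+1}^{C(n−1,k)} · (det A)^{C(n−1,k−1)} (Sylvester's identity for minors sharing the last row and column). -/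
open Matrix Finset

/-- The `k`-th compound matrix. -/
noncomputable def cmpd {K : Type*} [CommRing K] {n : ℕ} (k : ℕ) (M : Matrix (Fin n) (Fin n) K) :
    Matrix {s : Finset (Fin n) // s.card = k} {s : Finset (Fin n) // s.card = k} K :=
  Matrix.of fun I J => Matrix.det (Matrix.of fun a b : Fin k =>
    M (I.1.orderEmbOfFin I.2 a) (J.1.orderEmbOfFin J.2 b))

theorem det_cmpd_eq {K : Type*} [CommRing K] {n : ℕ} (k : ℕ) (M : Matrix (Fin n) (Fin n) K) :
    (cmpd k M).det = LinearMap.det (exteriorPower.map k (Matrix.toLin' M)) := by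
  classical
  rw [← LinearMap.det_toMatrix ((Pi.basisFun K (Fin n)).exteriorPower k)]
  have : LinearMap.toMatrix ((Pi.basisFun K (Fin n)).exteriorPower k)
      ((Pi.basisFun K (Fin n)).exteriorPower k) (exteriorPower.map k (Matrix.toLin' M))
      = cmpd k M := by
    ext I J
    rw [LinearMap.toMatrix_apply, exteriorPower.basis_apply, exteriorPower.basis_repr_apply,
      exteriorPower.ιMulti_family, exteriorPower.map_apply_ιMulti,
      exteriorPower.ιMultiDual_apply_ιMulti, ← Matrix.det_transpose]
    change _ = Matrix.det (Matrix.of fun a b : Fin k =>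
      M (I.1.orderEmbOfFin I.2 a) (J.1.orderEmbOfFin J.2 b))
    congr 1
    ext a b
    simp [Set.powersetCard.ofFinEmbEquiv_symm_apply]
  rw [this]
  have key : ∀ (f1 f2 : Fintype {s : Finset (Fin n) // s.card = k})
      (d1 d2 : DecidableEq {s : Finset (Fin n) // s.card = k}),
      @Matrix.det _ d1 f1 K _ (cmpd k M) = @Matrix.det _ d2 f2 K _ (cmpd k M) := by
    intro f1 f2 d1 d2
    rw [Subsingleton.elim f1 f2, Subsingleton.elim d1 d2]
  exact key _ _ _ _

theorem det_cmpd_mul {K : Type*} [CommRing K] {n : ℕ} (k : ℕ) (M N : Matrix (Fin n) (Fin n) K) :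
    (cmpd k (M * N)).det = (cmpd k M).det * (cmpd k N).det := by
  simp only [det_cmpd_eq]
  rw [Matrix.toLin'_mul, ← LinearMap.det_comp, exteriorPower.map_comp]

theorem det_cmpd_one {K : Type*} [CommRing K] {n : ℕ} (k : ℕ) :
    (cmpd k (1 : Matrix (Fin n) (Fin n) K)).det = 1 := by
  simp [det_cmpd_eq]

theorem cmpd_diagonal {K : Type*} [CommRing K] {n : ℕ} (k : ℕ) (d : Fin n → K) :
    cmpd k (Matrix.diagonal d) = Matrix.diagonal fun I => ∏ i ∈ I.1, d i := by
  ext I J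
  by_cases h : I = J
  · subst h
    rw [Matrix.diagonal_apply_eq, cmpd, Matrix.of_apply]
    have : (Matrix.of fun a b : Fin k => Matrix.diagonal d (I.1.orderEmbOfFin I.2 a)
        (I.1.orderEmbOfFin I.2 b)) = Matrix.diagonal fun a => d (I.1.orderEmbOfFin I.2 a) := by
      ext a b
      simp [Matrix.diagonal_apply]
    rw [this, Matrix.det_diagonal]
    conv_rhs => rw [← Finset.image_orderEmbOfFin_univ I.1 I.2]
    rw [Finset.prod_image]
    intro a _ b _ hab
    simpa using hab
  · rw [Matrix.diagonal_apply_ne _ h, cmpd, Matrix.of_apply]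
    have : ∃ i ∈ I.1, i ∉ J.1 := by
      by_contra! hc
      exact h (Subtype.ext (Finset.eq_of_subset_of_card_le hc (by rw [I.2, J.2])))
    obtain ⟨i, hi, hj⟩ := this
    have : i ∈ Set.range (I.1.orderEmbOfFin I.2) := by simpa using hi
    obtain ⟨a, rfl⟩ := this
    apply Matrix.det_eq_zero_of_row_eq_zero a
    intro b
    rw [Matrix.of_apply, Matrix.diagonal_apply_ne]
    intro hab
    rw [hab] at hj
    exact hj (Finset.orderEmbOfFin_mem _ _ _)

theorem card_containing {n k : ℕ} (i : Fin n) :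
    (Finset.univ.filter fun I : {s : Finset (Fin n) // s.card = k} => i ∈ I.1).card
      = if k = 0 then 0 else Nat.choose (n - 1) (k - 1) := by
  split_ifs with h
  · subst h
    rw [Finset.card_eq_zero, Finset.filter_eq_empty_iff]
    rintro ⟨I, hI⟩ -
    rw [Finset.card_eq_zero] at hI
    simp [hI]
  · have := Finset.card_powersetCard (k - 1) (Finset.univ.erase i)
    rw [Finset.card_erase_of_mem (Finset.mem_univ i), Finset.card_univ, Fintype.card_fin] at this
    rw [← this]
    refine Finset.card_bij' (fun I _ => I.1.erase i)
      (fun s hs => ⟨insert i s, ?_⟩) ?_ ?_ ?_ ?_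
    · rw [Finset.mem_powersetCard] at hs
      have : i ∉ s := fun hh => by simpa using hs.1 hh
      rw [Finset.card_insert_of_notMem this, hs.2]
      omega
    · rintro ⟨I, hI⟩ hi
      have hi : i ∈ I := by simpa using hi
      rw [Finset.mem_powersetCard]
      exact ⟨Finset.erase_subset_erase _ (Finset.subset_univ _),
        by rw [Finset.card_erase_of_mem hi, hI]⟩
    · intro s hs
      simp
    · rintro ⟨I, hI⟩ hi
      have hi : i ∈ I := by simpa using hi
      simp [Finset.insert_erase hi]
    · intro s hs
      rw [Finset.mem_powersetCard] at hs
      have : i ∉ s := fun hh => by simpa using hs.1 hh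
      simp [this]

theorem det_cmpd_diagonal {K : Type*} [CommRing K] {n : ℕ} (k : ℕ) (d : Fin n → K) :
    (cmpd k (Matrix.diagonal d)).det =
      (Matrix.diagonal d).det ^ (if k = 0 then 0 else Nat.choose (n - 1) (k - 1)) := by
  rw [cmpd_diagonal, Matrix.det_diagonal, Matrix.det_diagonal, ← Finset.prod_pow]
  have : ∀ I : {s : Finset (Fin n) // s.card = k},
      ∏ i ∈ I.1, d i = ∏ i, if i ∈ I.1 then d i else 1 := by
    intro I
    simp
  simp_rw [this]
  rw [Finset.prod_comm]
  refine Finset.prod_congr rfl fun i _ => ?_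
  rw [← card_containing (k := k) i, ← Finset.prod_filter, Finset.prod_const]

theorem det_cmpd {F : Type*} [Field F] [CharZero F] {n : ℕ} (k : ℕ)
    (M : Matrix (Fin n) (Fin n) F) :
    (cmpd k M).det = M.det ^ (if k = 0 then 0 else Nat.choose (n - 1) (k - 1)) := by
  refine Matrix.diagonal_transvection_induction (fun M => (cmpd k M).det =
    M.det ^ (if k = 0 then 0 else Nat.choose (n - 1) (k - 1))) M
    (fun D _ => det_cmpd_diagonal k D) ?_ ?_
  · rintro ⟨i, j, hij, c⟩
    rw [Matrix.TransvectionStruct.det, one_pow]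
    change (cmpd k (Matrix.transvection i j c)).det = 1
    set D : Matrix (Fin n) (Fin n) F := Matrix.diagonal fun l => if l = i then 2 else 1 with hD
    set E : Matrix (Fin n) (Fin n) F := Matrix.diagonal fun l => if l = i then 2⁻¹ else 1 with hE
    have h1 : D * E = 1 := by
      rw [hD, hE, Matrix.diagonal_mul_diagonal, ← Matrix.diagonal_one]
      congr 1
      ext l
      split_ifs <;> simp
    have h2 : Matrix.transvection i j c * Matrix.transvection i j (-c) = 1 := by
      rw [Matrix.transvection_mul_transvection_same _ _ hij]; simp
    have h3 : D * Matrix.transvection i j c = Matrix.transvection i j (2 * c) * D := by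
      ext a b
      rw [hD, Matrix.diagonal_mul, Matrix.mul_diagonal]
      simp only [Matrix.transvection, Matrix.add_apply, Matrix.one_apply, Matrix.single_apply]
      grind
    have h4 : Matrix.transvection i j (2 * c)
        = Matrix.transvection i j c * Matrix.transvection i j c := by
      rw [Matrix.transvection_mul_transvection_same _ _ hij, two_mul]
    rw [h4] at h3
    have e1 := congrArg (fun X => (cmpd k X).det) h1
    have e2 := congrArg (fun X => (cmpd k X).det) h2
    have e3 := congrArg (fun X => (cmpd k X).det) h3
    simp only [det_cmpd_mul, det_cmpd_one] at e1 e2 e3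
    have hd := left_ne_zero_of_mul_eq_one e1
    have ht := left_ne_zero_of_mul_eq_one e2
    apply mul_left_cancel₀ (mul_ne_zero ht hd)
    linear_combination -e3
  · intro A B hA hB
    rw [det_cmpd_mul, hA, hB, Matrix.det_mul, mul_pow]

theorem schur_det {F : Type*} [Field F] {m : ℕ} (B : Matrix (Fin (m + 1)) (Fin (m + 1)) F)
    (h : B (Fin.last m) (Fin.last m) ≠ 0) :
    B.det = B (Fin.last m) (Fin.last m) * Matrix.det (Matrix.of fun a b : Fin m =>
      B a.castSucc b.castSucc - B a.castSucc (Fin.last m) * (B (Fin.last m) (Fin.last m))⁻¹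
        * B (Fin.last m) b.castSucc) := by
  rw [← Matrix.det_submatrix_equiv_self (finSumFinEquiv (m := m) (n := 1)),
    ← Matrix.fromBlocks_toBlocks (B.submatrix _ _)]
  set X := B.submatrix (finSumFinEquiv (m := m) (n := 1)) (finSumFinEquiv (m := m) (n := 1))
  have hl : ∀ i : Fin 1, Fin.natAdd m i = Fin.last m := by
    intro i; ext; simp
  have hX : X.toBlocks₂₂ = Matrix.diagonal fun _ => B (Fin.last m) (Fin.last m) := by
    ext i j
    rw [Subsingleton.elim i 0, Subsingleton.elim j 0]
    simp [X, Matrix.toBlocks₂₂, hl]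
  have hi : X.toBlocks₂₂ * (Matrix.diagonal fun _ => (B (Fin.last m) (Fin.last m))⁻¹) = 1 := by
    rw [hX, Matrix.diagonal_mul_diagonal, ← Matrix.diagonal_one]
    simp [h]
  let _ : Invertible X.toBlocks₂₂ := ⟨_, mul_eq_one_comm.mp hi, hi⟩
  rw [Matrix.det_fromBlocks₂₂]
  have hinv : ⅟X.toBlocks₂₂ = Matrix.diagonal fun _ => (B (Fin.last m) (Fin.last m))⁻¹ := rfl
  rw [hinv]
  congr 1
  · rw [hX]; simp
  · congr 1
    ext a b
    simp [Matrix.mul_apply, X, Matrix.toBlocks₁₁, Matrix.toBlocks₁₂, Matrix.toBlocks₂₁, hl,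
      Matrix.diagonal_apply]
    rfl

theorem plus_emb {n k : ℕ} (I : {s : Finset (Fin n) // s.card = k}) :
    (fun a => ((I.1.plus.orderIsoOfFin (Finset.plus_card I.2)) a : Fin (n + 1))) =
      Fin.lastCases (motive := fun _ => Fin (n + 1)) (Fin.last n)
        (fun a => (I.1.orderEmbOfFin I.2 a).castSucc) := by
  symm
  apply Finset.orderEmbOfFin_unique (Finset.plus_card I.2)
  · intro x
    refine Fin.lastCases ?_ (fun a => ?_) x
    · simp [Finset.plus]
    · simp [Finset.plus]
  · intro x y
    refine Fin.lastCases ?_ (fun a => ?_) x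
    · intro h
      exact absurd h (not_lt.mpr (Fin.le_last y))
    · refine Fin.lastCases ?_ (fun b => ?_) y
      · intro h
        simp [Fin.castSucc_lt_last]
      · intro h
        simpa using h

theorem minorPlus_schur {F : Type*} [Field F] {n k : ℕ}
    (A : Matrix (Fin (n + 1)) (Fin (n + 1)) F) (h : A (Fin.last n) (Fin.last n) ≠ 0)
    (I J : {s : Finset (Fin n) // s.card = k}) :
    minorPlus A I J = A (Fin.last n) (Fin.last n) * cmpd k (Matrix.of fun a b : Fin n =>
      A a.castSucc b.castSucc - A a.castSucc (Fin.last n) * (A (Fin.last n) (Fin.last n))⁻¹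
        * A (Fin.last n) b.castSucc) I J := by
  have hI := congrFun (plus_emb I)
  have hJ := congrFun (plus_emb J)
  have e : minorPlus A I J = Matrix.det (Matrix.of fun a b : Fin (k + 1) =>
      A (Fin.lastCases (motive := fun _ => Fin (n + 1)) (Fin.last n)
        (fun a => (I.1.orderEmbOfFin I.2 a).castSucc) a)
        (Fin.lastCases (motive := fun _ => Fin (n + 1)) (Fin.last n)
        (fun a => (J.1.orderEmbOfFin J.2 a).castSucc) b)) := by
    unfold minorPlus
    congr 1
    ext a b
    exact congrArg₂ A (hI a) (hJ b)
  rw [e, schur_det _ (by simpa using h)]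
  simp [cmpd]

theorem sylvester_field {F : Type*} [Field F] [CharZero F] (n : ℕ) (k : ℕ) (hk : k ≤ n)
    (A : Matrix (Fin (n + 1)) (Fin (n + 1)) F) (h : A (Fin.last n) (Fin.last n) ≠ 0) :
    Matrix.det (Matrix.of fun I J : {s : Finset (Fin n) // s.card = k} => minorPlus A I J)
      = A (Fin.last n) (Fin.last n) ^ (Nat.choose (n - 1) k)
      * A.det ^ (if k = 0 then 0 else Nat.choose (n - 1) (k - 1)) := by
  rw [schur_det A h]
  set S : Matrix (Fin n) (Fin n) F := Matrix.of fun a b : Fin n =>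
      A a.castSucc b.castSucc - A a.castSucc (Fin.last n) * (A (Fin.last n) (Fin.last n))⁻¹
        * A (Fin.last n) b.castSucc with hS
  have : (Matrix.of fun I J : {s : Finset (Fin n) // s.card = k} => minorPlus A I J)
      = A (Fin.last n) (Fin.last n) • cmpd k S := by
    ext I J
    rw [Matrix.of_apply, minorPlus_schur A h]
    rfl
  rw [this, Matrix.det_smul, det_cmpd, mul_pow, ← mul_assoc, ← pow_add]
  congr 2
  rw [Fintype.card_finset_len, Fintype.card_fin]
  split_ifs with h0
  · subst h0; simp
  · obtain ⟨k, rfl⟩ := Nat.exists_eq_succ_of_ne_zero h0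
    obtain ⟨n, rfl⟩ := Nat.exists_eq_succ_of_ne_zero (show n ≠ 0 by omega)
    simp [Nat.choose_succ_succ, add_comm]

theorem minorPlus_map {R S : Type*} [CommRing R] [CommRing S] (f : R →+* S) {n k : ℕ}
    (A : Matrix (Fin (n + 1)) (Fin (n + 1)) R) (I J : {s : Finset (Fin n) // s.card = k}) :
    minorPlus (f.mapMatrix A) I J = f (minorPlus A I J) := by
  unfold minorPlus
  rw [RingHom.map_det]
  rfl

theorem sylvester_map {R S : Type*} [CommRing R] [CommRing S] (f : R →+* S) {n k : ℕ}
    (A : Matrix (Fin (n + 1)) (Fin (n + 1)) R) :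
    Matrix.det (Matrix.of fun I J : {s : Finset (Fin n) // s.card = k} =>
      minorPlus (f.mapMatrix A) I J)
    = f (Matrix.det (Matrix.of fun I J : {s : Finset (Fin n) // s.card = k} =>
      minorPlus A I J)) := by
  rw [RingHom.map_det]
  congr 1
  ext I J
  exact minorPlus_map f A I J

/-- Sylvester's identity for minors sharing the last row and column. -/
theorem sylvester_identity {K : Type*} [CommRing K] (n : ℕ) (k : ℕ) (hk : k ≤ n)
    (A : Matrix (Fin (n + 1)) (Fin (n + 1)) K)
    (W : Matrix {s : Finset (Fin n) // s.card = k} {s : Finset (Fin n) // s.card = k} K)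
    (hW : ∀ I J, W I J = minorPlus A I J) :
    W.det = A (Fin.last n) (Fin.last n) ^ (Nat.choose (n - 1) k)
      * A.det ^ (if k = 0 then 0 else Nat.choose (n - 1) (k - 1)) := by
  have hW' : W = Matrix.of fun I J => minorPlus A I J := by
    ext I J; exact hW I J
  subst hW'
  let X := Matrix.mvPolynomialX (Fin (n + 1)) (Fin (n + 1)) ℤ
  let R := MvPolynomial (Fin (n + 1) × Fin (n + 1)) ℤ
  let g : R →+* FractionRing R := algebraMap R (FractionRing R)
  have hg : Function.Injective g := IsFractionRing.injective R (FractionRing R)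
  have : CharZero (FractionRing R) := charZero_of_injective_algebraMap hg
  have key : Matrix.det (Matrix.of fun I J : {s : Finset (Fin n) // s.card = k} => minorPlus X I J)
      = X (Fin.last n) (Fin.last n) ^ (Nat.choose (n - 1) k)
      * X.det ^ (if k = 0 then 0 else Nat.choose (n - 1) (k - 1)) := by
    apply hg
    rw [← sylvester_map, sylvester_field n k hk]
    · rw [map_mul, map_pow, map_pow, RingHom.map_det]
      rfl
    · change g (X _ _) ≠ 0
      rw [map_ne_zero_iff g hg]
      exact MvPolynomial.X_ne_zero _
  let f : R →+* K := (MvPolynomial.aeval fun p : Fin (n + 1) × Fin (n + 1) => A p.1 p.2).toRingHom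
  have hf : f.mapMatrix X = A := Matrix.mvPolynomialX_mapMatrix_aeval ℤ A
  rw [← hf, sylvester_map, key, map_mul, map_pow, map_pow, RingHom.map_det f]
  rfl
end
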